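/- Fix an integer d ≥ 2 and let c_n denote the number of congruence subgroups of SL_d(ℤ) of index at most n. Then there exist real constants a, b > 0 and an integer N such that for all n ≥ N one has n^(a·log n / log log n) ≤ c_n ≤ n^(b·log n / log log n). -/

import Mathlib

open Filter

/-- `H` is a congruence subgroup of `SL_d(ℤ)`: it contains the kernel of the
reduction homomorphism `SL_d(ℤ) → SL_d(ℤ/mℤ)` for some integer `m ≥ 1`. -/
def IsCongruenceSubgroup {d : ℕ} (H : Subgroup (Matrix.SpecialLinearGroup (Fin d) ℤ)) : Prop :=
  ∃ m : ℕ, 1 ≤ m ∧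
    (Matrix.SpecialLinearGroup.map (n := Fin d) (Int.castRingHom (ZMod m))).ker ≤ H

/-- The number of congruence subgroups of `SL_d(ℤ)` of index at most `n`. -/
noncomputable def congCount (d n : ℕ) : ℕ :=
  Nat.card {H : Subgroup (Matrix.SpecialLinearGroup (Fin d) ℤ) //
    IsCongruenceSubgroup H ∧ H.index ≤ n}



namespace CG
open Finset

/-- truncated alternating sum -/
noncomputable def trunc (P : Finset ℕ) (b : ℕ) (e : ℕ → ℝ) : ℝ :=
  ∑ D ∈ P.powerset with D.card ≤ b, ∏ p ∈ D, (- e p)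

lemma trunc_bonf (P : Finset ℕ) (b : ℕ) (e : ℕ → ℝ) (he : ∀ p ∈ P, e p = 0 ∨ e p = 1) :
    ∏ p ∈ P, (1 - e p) ≤ trunc P (2*b) e := by
  classical
  set Q := P.filter (fun p => e p = 1) with hQ
  have h1 : trunc P (2*b) e = ∑ D ∈ Q.powerset, (if D.card ≤ 2*b then (-1:ℝ)^(D.card) else 0) := by
    rw [trunc, ← Finset.sum_filter]
    symm
    refine Finset.sum_subset_zero_on_sdiff ?_ ?_ ?_
    · intro D hD
      simp only [mem_filter, mem_powerset] at hD ⊢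
      exact ⟨hD.1.trans (Finset.filter_subset _ _), hD.2⟩
    · intro D hD
      simp only [Finset.mem_sdiff, mem_filter, mem_powerset, not_and] at hD
      obtain ⟨⟨hD1, hD2⟩, hD3⟩ := hD
      have : ¬ D ⊆ Q := fun h => hD3 h hD2
      rw [Finset.not_subset] at this
      obtain ⟨p, hp, hpQ⟩ := this
      refine Finset.prod_eq_zero hp ?_
      rcases he p (hD1 hp) with h | h
      · simp [h]
      · exact absurd (by simp [hQ, h, hD1 hp]) hpQ
    · intro D hD
      simp only [mem_filter, mem_powerset] at hD
      rw [Finset.prod_congr rfl (g := fun _ => (-1:ℝ))]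
      · simp
      · intro p hp
        have := hD.1 hp
        simp only [hQ, mem_filter] at this
        rw [this.2]
  have h2 : trunc P (2*b) e = ∑ i ∈ range (2*b+1), (-1:ℝ)^i * (Q.card.choose i) := by
    rw [h1, Finset.sum_powerset_apply_card (fun i => if i ≤ 2*b then (-1:ℝ)^i else 0)]
    have e1 : ∑ m ∈ range (Q.card+1), Q.card.choose m • (if m ≤ 2*b then (-1:ℝ)^m else 0)
        = ∑ m ∈ range (Q.card+1+(2*b+1)), Q.card.choose m • (if m ≤ 2*b then (-1:ℝ)^m else 0) := by
      refine Finset.sum_subset (by intro x; simp; omega) ?_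
      intro x _ hx
      simp only [mem_range, not_lt] at hx
      rw [Nat.choose_eq_zero_of_lt (by omega)]; simp
    rw [e1]
    symm
    have e2 : ∀ i ∈ range (2*b+1), (-1:ℝ)^i * (Q.card.choose i) = Q.card.choose i • (if i ≤ 2*b then (-1:ℝ)^i else 0) := by
      intro i hi
      simp only [mem_range] at hi
      rw [if_pos (by omega)]; simp [mul_comm]
    rw [Finset.sum_congr rfl e2]
    refine Finset.sum_subset (by intro x; simp; omega) ?_
    intro x _ hx
    simp only [mem_range, not_lt] at hx
    rw [if_neg (by omega)]; simp
  rw [h2]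
  rcases Nat.eq_zero_or_pos Q.card with h0 | h0
  · rw [h0]
    have : ∏ p ∈ P, (1 - e p) = 1 := by
      refine Finset.prod_eq_one ?_
      intro p hp
      rcases he p hp with h | h
      · simp [h]
      · exfalso
        rw [Finset.card_eq_zero] at h0
        have : p ∈ Q := by simp [hQ, h, hp]
        rw [h0] at this; simp at this
    rw [this, Finset.sum_range_succ']
    simp
  · obtain ⟨k, hk⟩ : ∃ k, Q.card = k + 1 := ⟨Q.card - 1, by omega⟩
    have := @Int.alternating_sum_range_choose_eq_choose k (2*b)
    have h3 : ∑ i ∈ range (2*b+1), (-1:ℝ)^i * ((k+1).choose i) = (k.choose (2*b) : ℝ) := by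
      have := congrArg (fun z : ℤ => (z:ℝ)) this
      push_cast at this
      rw [this]; simp
    rw [hk, h3]
    obtain ⟨p, hp⟩ := Finset.card_pos.mp h0
    simp only [hQ, mem_filter] at hp
    rw [Finset.prod_eq_zero hp.1 (by rw [hp.2]; ring)]
    positivity

lemma sum_card_trunc (P : Finset ℕ) (b : ℕ) :
    ∑ D ∈ P.powerset with D.card ≤ b, (2:ℝ)^D.card ≤ (1 + 2 * (P.card:ℝ))^b := by
  classical
  rw [Finset.sum_filter, Finset.sum_powerset_apply_card (fun i => if i ≤ b then (2:ℝ)^i else 0)]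
  have : ∀ m ∈ range (P.card+1), P.card.choose m • (if m ≤ b then (2:ℝ)^m else 0) ≤
      if m ∈ range (b+1) then (b.choose m : ℝ) * (2 * (P.card:ℝ))^m else 0 := by
    intro m _
    by_cases h : m ≤ b
    · rw [if_pos h, if_pos (by simp; omega), mul_pow, nsmul_eq_mul]
      have h1 : (P.card.choose m : ℝ) ≤ (P.card:ℝ)^m := by exact_mod_cast Nat.choose_le_pow _ _
      have h2 : (1:ℝ) ≤ b.choose m := by exact_mod_cast Nat.choose_pos h
      calc (P.card.choose m : ℝ) * 2^m ≤ (P.card:ℝ)^m * 2^m := by gcongr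
        _ = 1 * (2^m * (P.card:ℝ)^m) := by ring
        _ ≤ _ := by gcongr
    · simp [h]
  refine (Finset.sum_le_sum this).trans ?_
  rw [← Finset.sum_filter, show 1 + 2 * (P.card:ℝ) = 2 * (P.card:ℝ) + 1 from add_comm _ _, add_pow]
  refine (Finset.sum_le_sum_of_subset_of_nonneg (t := range (b+1)) ?_ ?_).trans ?_
  · intro x hx; simp at hx ⊢; omega
  · intros; positivity
  · refine Finset.sum_le_sum fun m _ => ?_
    simp [mul_comm]

/-- one congruence condition -/
lemma count_mod (N d : ℕ) (hd : 0 < d) (v : ℕ) :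
    |(((range N).filter (fun n => n ≡ v [MOD d])).card : ℝ) - N / d| ≤ 1 := by
  have h := Nat.count_modEq_card N hd v
  rw [Nat.count_eq_card_filter_range] at h
  rw [h]
  have h1 : (N:ℝ) = d * (N/d : ℕ) + (N % d : ℕ) := by exact_mod_cast (Nat.div_add_mod N d).symm
  have h2 : ((N % d : ℕ):ℝ) < d := by exact_mod_cast Nat.mod_lt _ hd
  have h3 : (0:ℝ) ≤ ((N % d : ℕ):ℝ) := by positivity
  have hd' : (0:ℝ) < d := by exact_mod_cast hd
  have h4 : (N:ℝ)/d = (N/d : ℕ) + ((N % d : ℕ):ℝ)/d := by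
    conv_lhs => rw [h1]
    field_simp
  have h5 : ((N % d : ℕ):ℝ)/d ≤ 1 := by rw [div_le_one hd']; exact h2.le
  have h6 : 0 ≤ ((N % d : ℕ):ℝ)/d := by positivity
  rw [h4, abs_le]
  push_cast
  split_ifs <;> constructor <;> push_cast <;> linarith

lemma prod_coprime_dvd (E : Finset ℕ) (hE : ∀ p ∈ E, p.Prime) (n : ℕ) :
    (∀ p ∈ E, p ∣ n) ↔ (∏ p ∈ E, p) ∣ n := by
  constructor
  · intro h
    exact Finset.prod_primes_dvd n (fun p hp => (hE p hp).prime) h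
  · intro h p hp
    exact (Finset.dvd_prod_of_mem _ hp).trans h

noncomputable def sfun (r p : ℕ) : ℝ := if p ∣ r then 0 else 1

lemma count_EF (r N : ℕ) (E F : Finset ℕ) (hE : ∀ p ∈ E, p.Prime) (hF : ∀ p ∈ F, p.Prime)
    (hEF : Disjoint E F) :
    |(((range N).filter (fun n => (∀ p ∈ E, p ∣ n) ∧ (∀ p ∈ F, p ∣ r * n + 1))).card : ℝ)
      - N * ((∏ p ∈ E, (1/(p:ℝ))) * ∏ p ∈ F, (sfun r p / p))| ≤ 1 := by
  classical
  by_cases hs : ∃ p ∈ F, p ∣ r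
  · obtain ⟨p, hp, hpr⟩ := hs
    rw [Finset.prod_eq_zero (s := F) hp (by simp [sfun, hpr])]
    rw [Finset.filter_false_of_mem]
    · simp
    · rintro n - ⟨-, h⟩
      have h1 := h p hp
      have h2 : p ∣ r * n := hpr.mul_right n
      have h3 : p ∣ 1 := (Nat.dvd_add_right h2).mp h1
      exact (hF p hp).one_lt.ne' (Nat.dvd_one.mp h3)
  · push Not at hs
    set a := ∏ p ∈ E, p with ha
    set b := ∏ p ∈ F, p with hb
    have ha0 : 0 < a := Finset.prod_pos fun p hp => (hE p hp).pos
    have hb0 : 0 < b := Finset.prod_pos fun p hp => (hF p hp).pos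
    have hab : a.Coprime b := by
      refine Nat.Coprime.prod_left fun p hp => Nat.Coprime.prod_right fun q hq => ?_
      exact (Nat.coprime_primes (hE p hp) (hF q hq)).mpr (fun h => Finset.disjoint_left.mp hEF hp (h ▸ hq))
    have hrb : r.Coprime b := by
      refine Nat.Coprime.prod_right fun q hq => ?_
      exact ((Nat.Prime.coprime_iff_not_dvd (hF q hq)).mpr (hs q hq)).symm
    -- solution of r x + 1 ≡ 0 mod b
    obtain ⟨c, hc⟩ : ∃ c : ℕ, b ∣ r * c + 1 := by
      have : IsUnit (r : ZMod b) := (ZMod.isUnit_iff_coprime r b).mpr hrb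
      obtain ⟨u, hu⟩ := this
      have : NeZero b := ⟨hb0.ne'⟩
      refine ⟨(-(u⁻¹ : (ZMod b)ˣ) : ZMod b).val, ?_⟩
      rw [← ZMod.natCast_eq_zero_iff]
      push_cast
      rw [ZMod.natCast_zmod_val, ← hu]; simp
    obtain ⟨v, hv1, hv2⟩ := Nat.chineseRemainder hab 0 c
    have key : ∀ n, ((∀ p ∈ E, p ∣ n) ∧ (∀ p ∈ F, p ∣ r * n + 1)) ↔ n ≡ v [MOD (a*b)] := by
      intro n
      rw [prod_coprime_dvd E hE, prod_coprime_dvd F hF, ← Nat.modEq_and_modEq_iff_modEq_mul hab]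
      refine and_congr ?_ ?_
      · rw [← Nat.modEq_zero_iff_dvd]
        exact ⟨fun h => h.trans hv1.symm, fun h => h.trans hv1⟩
      · rw [← Nat.modEq_zero_iff_dvd] at hc ⊢
        constructor
        · intro h
          have h2 : r * n + 1 ≡ r * c + 1 [MOD b] := h.trans hc.symm
          have h3 : r * n ≡ r * c [MOD b] := Nat.ModEq.add_right_cancel' 1 h2
          exact (Nat.ModEq.cancel_left_of_coprime hrb.symm h3).trans hv2.symm
        · intro h
          exact ((h.trans hv2).mul_left r |>.add_right 1).trans hc
    simp_rw [key]
    have e1 : (∏ p ∈ E, (1/(p:ℝ))) * ∏ p ∈ F, (sfun r p / p) = 1 / ((a*b : ℕ):ℝ) := by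
      have : ∏ p ∈ F, (sfun r p / p) = ∏ p ∈ F, (1/(p:ℝ)) :=
        Finset.prod_congr rfl fun p hp => by simp [sfun, hs p hp]
      rw [this, ha, hb]; push_cast
      simp [mul_comm]
    rw [e1, mul_one_div]
    exact count_mod N (a*b) (by positivity) v

noncomputable def gfun (r p : ℕ) : ℝ := 1/(p:ℝ) + sfun r p / p

noncomputable def efun (r n p : ℕ) : ℝ := (if p ∣ n then 1 else 0) + (if p ∣ r * n + 1 then 1 else 0)

lemma efun_zero_one (r n p : ℕ) (hp : p.Prime) : efun r n p = 0 ∨ efun r n p = 1 := by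
  unfold efun
  by_cases h1 : p ∣ n
  · have : ¬ p ∣ r * n + 1 := by
      intro h
      exact hp.one_lt.ne' (Nat.dvd_one.mp ((Nat.dvd_add_right (h1.mul_left r)).mp h))
    simp [h1, this]
  · by_cases h2 : p ∣ r * n + 1 <;> simp [h1, h2]

lemma count_D (r N : ℕ) (D : Finset ℕ) (hD : ∀ p ∈ D, p.Prime) :
    |(∑ n ∈ range N, ∏ p ∈ D, efun r n p) - N * ∏ p ∈ D, gfun r p| ≤ (2:ℝ) ^ D.card := by
  have e1 : ∑ n ∈ range N, ∏ p ∈ D, efun r n p = ∑ E ∈ D.powerset,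
      (((range N).filter (fun n => (∀ p ∈ E, p ∣ n) ∧ (∀ p ∈ D \ E, p ∣ r * n + 1))).card : ℝ) := by
    simp_rw [efun, Finset.prod_add]
    rw [Finset.sum_comm]
    refine Finset.sum_congr rfl fun E hE => ?_
    rw [Finset.card_filter]
    push_cast
    refine Finset.sum_congr rfl fun n _ => ?_
    rw [Finset.prod_ite_zero, Finset.prod_ite_zero, prod_const_one, prod_const_one]
    by_cases h1 : ∀ p ∈ E, p ∣ n
    · by_cases h2 : ∀ p ∈ D \ E, p ∣ r * n + 1
      · rw [if_pos h1, if_pos h2, if_pos ⟨h1, h2⟩, mul_one]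
      · rw [if_pos h1, if_neg h2, if_neg (fun h => h2 h.2), mul_zero]
    · rw [if_neg h1, zero_mul, if_neg (fun h => h1 h.1)]
  have e2 : N * ∏ p ∈ D, gfun r p = ∑ E ∈ D.powerset,
      N * ((∏ p ∈ E, (1/(p:ℝ))) * ∏ p ∈ D \ E, (sfun r p / p)) := by
    simp_rw [gfun, Finset.prod_add, Finset.mul_sum]
  rw [e1, e2, ← Finset.sum_sub_distrib]
  refine (Finset.abs_sum_le_sum_abs _ _).trans ?_
  have : (2:ℝ)^D.card = ∑ E ∈ D.powerset, (1:ℝ) := by simp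
  rw [this]
  refine Finset.sum_le_sum fun E hE => ?_
  rw [mem_powerset] at hE
  have h3 := count_EF r N E (D \ E) (fun p hp => hD p (hE hp)) (fun p hp => hD p (sdiff_subset hp)) disjoint_sdiff
  exact h3

/-- general sieve inequality -/
lemma sieve_general {J : ℕ} (r N : ℕ) (P : Fin J → Finset ℕ) (hP : ∀ j, ∀ p ∈ P j, p.Prime)
    (hdisj : Pairwise (fun i j => Disjoint (P i) (P j))) (b : Fin J → ℕ) :
    (((range N).filter (fun n => ∀ j, ∀ p ∈ P j, ¬ p ∣ n ∧ ¬ p ∣ r * n + 1)).card : ℝ) ≤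
      N * ∏ j, trunc (P j) (2 * b j) (gfun r) + ∏ j, (1 + 2 * ((P j).card:ℝ))^(2 * b j) := by
  classical
  have step1 : (((range N).filter (fun n => ∀ j, ∀ p ∈ P j, ¬ p ∣ n ∧ ¬ p ∣ r * n + 1)).card : ℝ) ≤
      ∑ n ∈ range N, ∏ j, trunc (P j) (2 * b j) (efun r n) := by
    rw [Finset.card_filter]; push_cast
    refine Finset.sum_le_sum fun n _ => ?_
    have hb : ∀ j, ∏ p ∈ P j, (1 - efun r n p) ≤ trunc (P j) (2 * b j) (efun r n) := fun j =>
      trunc_bonf _ _ _ fun p hp => efun_zero_one r n p (hP j p hp)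
    have hnn : ∀ j, 0 ≤ ∏ p ∈ P j, (1 - efun r n p) := fun j =>
      Finset.prod_nonneg fun p hp => by rcases efun_zero_one r n p (hP j p hp) with h | h <;> simp [h]
    refine le_trans ?_ (Finset.prod_le_prod (fun j _ => hnn j) (fun j _ => hb j))
    split_ifs with h
    · rw [Finset.prod_eq_one]
      intro j _
      refine Finset.prod_eq_one fun p hp => ?_
      simp [efun, (h j p hp).1, (h j p hp).2]
    · exact Finset.prod_nonneg fun j _ => hnn j
  refine step1.trans ?_
  have expand : ∀ f : ℕ → ℝ, ∏ j, trunc (P j) (2 * b j) f =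
      ∑ x ∈ Fintype.piFinset (fun j => (P j).powerset.filter (fun D => D.card ≤ 2 * b j)),
        (-1)^(Finset.univ.biUnion x).card * ∏ p ∈ Finset.univ.biUnion x, f p := by
    intro f
    simp_rw [trunc]
    rw [Finset.prod_univ_sum]
    refine Finset.sum_congr rfl fun x hx => ?_
    rw [Fintype.mem_piFinset] at hx
    rw [← Finset.prod_const, ← Finset.prod_mul_distrib, Finset.prod_biUnion]
    · simp
    · intro i _ j _ hij
      have hi := hx i; have hj := hx j
      simp only [mem_filter, mem_powerset] at hi hj
      exact Finset.disjoint_of_subset_left hi.1 (Finset.disjoint_of_subset_right hj.1 (hdisj hij))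
  simp_rw [expand]
  rw [Finset.sum_comm]
  have err : ∏ j, (1 + 2 * ((P j).card:ℝ))^(2 * b j) ≥
     ∑ x ∈ Fintype.piFinset (fun j => (P j).powerset.filter (fun D => D.card ≤ 2 * b j)),
        (2:ℝ)^(Finset.univ.biUnion x).card := by
    have : ∏ j, (1 + 2 * ((P j).card:ℝ))^(2 * b j) ≥ ∏ j, ∑ D ∈ (P j).powerset with D.card ≤ 2 * b j, (2:ℝ)^D.card :=
      Finset.prod_le_prod (fun j _ => by positivity) (fun j _ => sum_card_trunc _ _)
    refine le_trans ?_ this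
    rw [Finset.prod_univ_sum]
    refine Finset.sum_le_sum fun x hx => ?_
    rw [Finset.prod_pow_eq_pow_sum]
    exact pow_le_pow_right₀ (by norm_num) Finset.card_biUnion_le
  refine le_trans ?_ (add_le_add le_rfl err)
  rw [Finset.mul_sum, ← Finset.sum_add_distrib]
  refine Finset.sum_le_sum fun x hx => ?_
  rw [Fintype.mem_piFinset] at hx
  rw [← Finset.mul_sum]
  set D := Finset.univ.biUnion x
  have hD : ∀ p ∈ D, p.Prime := by
    intro p hp
    simp only [D, mem_biUnion, mem_univ, true_and] at hp
    obtain ⟨j, hj⟩ := hp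
    have := hx j
    simp only [mem_filter, mem_powerset] at this
    exact hP j p (this.1 hj)
  have := abs_le.mp (count_D r N D hD)
  rcases neg_one_pow_eq_or ℝ D.card with h | h <;> rw [h] <;> nlinarith [this.1, this.2]

end CG


namespace CG
open Finset

lemma dyadic_sum (i : ℕ) (hi : 1 ≤ i) :
    ∑ p ∈ (Ioc (2^i) (2^(i+1))).filter Nat.Prime, (1/(p:ℝ)) ≤ 4 / i := by
  set Q := (Ioc (2^i) (2^(i+1))).filter Nat.Prime with hQ
  have h1 : (2^i)^Q.card ≤ ∏ p ∈ Q, p := by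
    rw [← Finset.prod_const]
    refine Finset.prod_le_prod' fun p hp => ?_
    simp only [hQ, mem_filter, mem_Ioc] at hp
    exact hp.1.1.le
  have h2 : ∏ p ∈ Q, p ≤ primorial (2^(i+1)) := by
    rw [primorial]
    refine Finset.prod_le_prod_of_subset_of_one_le' ?_ ?_
    · intro p hp
      simp only [hQ, mem_filter, mem_Ioc, mem_range] at hp ⊢
      exact ⟨by omega, hp.2⟩
    · intro p hp _
      simp only [mem_filter] at hp
      exact hp.2.one_lt.le
  have h3 := (h1.trans h2).trans (primorial_le_four_pow (2^(i+1)))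
  have h4 : i * Q.card ≤ 2^(i+2) := by
    have : (4:ℕ)^(2^(i+1)) = 2^(2^(i+2)) := by
      rw [show (4:ℕ) = 2^2 by norm_num, ← pow_mul]; congr 1; ring
    rw [this, ← pow_mul] at h3
    exact (Nat.pow_le_pow_iff_right (by norm_num)).mp h3
  have h5 : ∑ p ∈ Q, (1/(p:ℝ)) ≤ ∑ p ∈ Q, (1/(2:ℝ)^i) := by
    refine Finset.sum_le_sum fun p hp => ?_
    simp only [hQ, mem_filter, mem_Ioc] at hp
    refine one_div_le_one_div_of_le (by positivity) ?_
    exact_mod_cast hp.1.1.le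
  refine h5.trans ?_
  rw [Finset.sum_const, nsmul_eq_mul, mul_one_div]
  have hi' : (0:ℝ) < i := by exact_mod_cast hi
  rw [div_le_div_iff₀ (by positivity) hi']
  have : ((i * Q.card : ℕ):ℝ) ≤ ((2^(i+2) : ℕ) : ℝ) := by exact_mod_cast h4
  push_cast at this
  rw [pow_add] at this
  linarith

lemma dyadic_sum_range (a k : ℕ) (ha : 1 ≤ a) :
    ∑ p ∈ (Ioc (2^a) (2^(a+k))).filter Nat.Prime, (1/(p:ℝ)) ≤ k * (4 / a) := by
  induction k with
  | zero => simp
  | succ k ih =>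
    have : (Ioc (2^a) (2^(a+(k+1)))).filter Nat.Prime =
        (Ioc (2^a) (2^(a+k))).filter Nat.Prime ∪ (Ioc (2^(a+k)) (2^(a+k+1))).filter Nat.Prime := by
      rw [← Finset.filter_union, Finset.Ioc_union_Ioc_eq_Ioc]
      · rfl
      · exact Nat.pow_le_pow_right (by norm_num) (by omega)
      · exact Nat.pow_le_pow_right (by norm_num) (by omega)
    rw [this, Finset.sum_union]
    · have h1 := dyadic_sum (a+k) (by omega)
      have h2 : (4:ℝ) / ((a+k : ℕ):ℝ) ≤ 4 / a := by
        have : (0:ℝ) < a := by exact_mod_cast ha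
        refine div_le_div_of_nonneg_left (by norm_num) this ?_
        push_cast; linarith [(Nat.cast_nonneg k : (0:ℝ) ≤ k)]
      push_cast
      linarith
    · refine Finset.disjoint_left.mpr ?_
      intro p hp hq
      simp only [mem_filter, mem_Ioc] at hp hq
      omega

/-- primes in a doubly dyadic block -/
def block (j : ℕ) : Finset ℕ := (Ioc (2^2^j) (2^2^(j+1))).filter Nat.Prime

lemma mem_block {j p : ℕ} : p ∈ block j ↔ (2^2^j < p ∧ p ≤ 2^2^(j+1)) ∧ p.Prime := by
  simp [block]

lemma three_le_of_mem_block {j p : ℕ} (h : p ∈ block j) : 3 ≤ p := by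
  have h1 := (mem_block.mp h).1.1
  have : 2^1 ≤ 2^2^j := Nat.pow_le_pow_right (by norm_num) (Nat.one_le_two_pow)
  omega

lemma block_sum (j : ℕ) : ∑ p ∈ block j, (1/(p:ℝ)) ≤ 4 := by
  have := dyadic_sum_range (2^j) (2^j) Nat.one_le_two_pow
  have e : 2^j + 2^j = 2^(j+1) := by ring
  rw [e] at this
  refine this.trans (le_of_eq ?_)
  push_cast
  field_simp

lemma gfun_nonneg (r p : ℕ) : 0 ≤ gfun r p := by
  unfold gfun sfun; split_ifs <;> positivity

lemma gfun_le (r p : ℕ) : gfun r p ≤ 2 * (1/(p:ℝ)) := by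
  unfold gfun sfun
  have : 0 ≤ 1/(p:ℝ) := by positivity
  split_ifs
  · simp only [zero_div]; linarith
  · linarith

lemma block_gsum (r j : ℕ) : ∑ p ∈ block j, gfun r p ≤ 8 := by
  calc _ ≤ ∑ p ∈ block j, 2 * (1/(p:ℝ)) := Finset.sum_le_sum fun p _ => gfun_le r p
    _ = 2 * ∑ p ∈ block j, (1/(p:ℝ)) := by rw [Finset.mul_sum]
    _ ≤ 8 := by linarith [block_sum j]

lemma gfun_le_two_thirds {r j p : ℕ} (h : p ∈ block j) : gfun r p ≤ 2/3 := by
  have h3 : (3:ℝ) ≤ p := by exact_mod_cast three_le_of_mem_block h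
  have : 1/(p:ℝ) ≤ 1/3 := one_div_le_one_div_of_le (by norm_num) h3
  linarith [gfun_le r p]

lemma exp_le_one_sub {g : ℝ} (h0 : 0 ≤ g) (h1 : g ≤ 2/3) : Real.exp (-2*g) ≤ 1 - g := by
  have hc : Real.exp (2*g) ≥ 1 + 2*g + (2*g)^2/2 := by
    have := Real.quadratic_le_exp_of_nonneg (x := 2*g) (by linarith)
    linarith
  have : Real.exp (-2*g) * Real.exp (2*g) = 1 := by rw [← Real.exp_add]; simp
  have hp := Real.exp_pos (-2*g)
  have : Real.exp (-2*g) * (1 + 2*g + (2*g)^2/2) ≤ 1 := by nlinarith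
  have h2 : 1 ≤ (1-g) * (1 + 2*g + (2*g)^2/2) := by nlinarith [mul_nonneg h0 h0]
  have h3 : 0 < 1 + 2*g + (2*g)^2/2 := by positivity
  by_contra hcon
  push Not at hcon
  nlinarith

lemma block_disjoint {i j : ℕ} (h : i ≠ j) : Disjoint (block i) (block j) := by
  have key : ∀ {i j : ℕ}, i < j → Disjoint (block i) (block j) := by
    intro i j hij
    rw [Finset.disjoint_left]
    intro p hp hq
    have h1 := (mem_block.mp hp).1.2
    have h2 := (mem_block.mp hq).1.1
    have : 2^2^(i+1) ≤ 2^2^j := Nat.pow_le_pow_right (by norm_num) (Nat.pow_le_pow_right (by norm_num) hij)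
    omega
  rcases lt_or_gt_of_ne h with h | h
  · exact key h
  · exact (key h).symm

lemma trunc_le (r j b : ℕ) : |trunc (block j) (2*b) (gfun r)| ≤
    (∏ p ∈ block j, (1 - gfun r p)) * (1 + Real.exp 32 * (1/4)^b) := by
  classical
  set P := block j
  have h1 : ∏ p ∈ P, (1 - gfun r p) = ∑ D ∈ P.powerset, ∏ p ∈ D, (- gfun r p) := by
    rw [← Finset.prod_one_add]; rfl
  have h2 : trunc P (2*b) (gfun r) = ∏ p ∈ P, (1 - gfun r p) -
      ∑ D ∈ P.powerset with ¬ D.card ≤ 2*b, ∏ p ∈ D, (- gfun r p) := by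
    rw [h1, trunc, ← Finset.sum_filter_add_sum_filter_not P.powerset (fun D => D.card ≤ 2*b)]; ring
  have h3 : |∑ D ∈ P.powerset with ¬ D.card ≤ 2*b, ∏ p ∈ D, (- gfun r p)| ≤
      (1/4)^b * ∏ p ∈ P, (1 + 2 * gfun r p) := by
    rw [Finset.prod_one_add, Finset.mul_sum]
    refine (Finset.abs_sum_le_sum_abs _ _).trans ?_
    refine (Finset.sum_le_sum (g := fun D => (1/4)^b * ∏ p ∈ D, (2 * gfun r p)) ?_).trans ?_
    · intro D hD
      simp only [mem_filter, not_le] at hD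
      have hg : 0 ≤ ∏ p ∈ D, gfun r p := Finset.prod_nonneg fun p _ => gfun_nonneg r p
      rw [Finset.prod_mul_distrib, Finset.prod_const, Finset.prod_neg]
      have e1 : (1:ℝ) ≤ (1/4)^b * 2^D.card := by
        have : (2:ℝ)^(2*b) ≤ 2^D.card := pow_le_pow_right₀ (by norm_num) hD.2.le
        rw [pow_mul] at this
        calc (1:ℝ) = (1/4)^b * (2^2)^b := by rw [← mul_pow]; norm_num
          _ ≤ _ := by gcongr
      have e2 : |((-1:ℝ)^D.card * ∏ p ∈ D, gfun r p)| ≤ ∏ p ∈ D, gfun r p := by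
        rw [abs_mul, abs_pow, abs_neg, abs_one, one_pow, one_mul, abs_of_nonneg hg]
      refine e2.trans ?_
      rw [← mul_assoc]
      exact le_mul_of_one_le_left hg e1
    · refine Finset.sum_le_sum_of_subset_of_nonneg (Finset.filter_subset _ _) ?_
      intro D _ _
      exact mul_nonneg (by positivity) (Finset.prod_nonneg fun p _ => by linarith [gfun_nonneg r p])
  have hsum := block_gsum r j
  have h4 : ∏ p ∈ P, (1 + 2 * gfun r p) ≤ Real.exp 16 := by
    calc _ ≤ ∏ p ∈ P, Real.exp (2 * gfun r p) := by
          refine Finset.prod_le_prod (fun p _ => by linarith [gfun_nonneg r p]) fun p _ => ?_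
          rw [add_comm]; exact Real.add_one_le_exp _
      _ = Real.exp (2 * ∑ p ∈ P, gfun r p) := by rw [← Real.exp_sum, Finset.mul_sum]
      _ ≤ _ := Real.exp_le_exp.mpr (by linarith)
  have h5 : Real.exp (-16) ≤ ∏ p ∈ P, (1 - gfun r p) := by
    calc Real.exp (-16) ≤ Real.exp (∑ p ∈ P, (-2) * gfun r p) := by
          rw [← Finset.mul_sum]; exact Real.exp_le_exp.mpr (by linarith)
      _ = ∏ p ∈ P, Real.exp (-2 * gfun r p) := Real.exp_sum _ _
      _ ≤ _ := Finset.prod_le_prod (fun p _ => (Real.exp_pos _).le) fun p hp =>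
          exp_le_one_sub (gfun_nonneg r p) (gfun_le_two_thirds hp)
  have h6 : Real.exp 16 ≤ (∏ p ∈ P, (1 - gfun r p)) * Real.exp 32 := by
    calc Real.exp 16 = Real.exp (-16) * Real.exp 32 := by rw [← Real.exp_add]; norm_num
      _ ≤ _ := by gcongr
  have h7 : (0:ℝ) ≤ (1/4)^b := by positivity
  rw [h2]
  have h8 : 0 ≤ ∏ p ∈ P, (1 - gfun r p) := (Real.exp_pos _).le.trans h5
  refine (abs_sub _ _).trans ?_
  rw [abs_of_nonneg h8]
  nlinarith [mul_le_mul_of_nonneg_left (h4.trans h6) h7]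

lemma prod_corr (J : ℕ) : ∏ j : Fin J, (1 + Real.exp 32 * (1/4:ℝ)^(J - (j:ℕ))) ≤ Real.exp (Real.exp 32) := by
  calc _ ≤ ∏ j : Fin J, Real.exp (Real.exp 32 * (1/4:ℝ)^(J - (j:ℕ))) := by
        refine Finset.prod_le_prod (fun _ _ => by positivity) fun j _ => ?_
        rw [add_comm]; exact Real.add_one_le_exp _
    _ = Real.exp (∑ j : Fin J, Real.exp 32 * (1/4:ℝ)^(J - (j:ℕ))) := (Real.exp_sum _ _).symm
    _ ≤ _ := by
      refine Real.exp_le_exp.mpr ?_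
      rw [← Finset.mul_sum, Fin.sum_univ_eq_sum_range (fun j => (1/4:ℝ)^(J-j)) J]
      have : ∑ j ∈ range J, (1/4:ℝ)^(J-j) ≤ 1 := by
        rw [← Finset.sum_range_reflect]
        have : ∀ j ∈ range J, (1/4:ℝ)^(J-(J-1-j)) = 1/4 * (1/4)^j := by
          intro j hj
          simp only [mem_range] at hj
          rw [show J-(J-1-j) = j+1 by omega, pow_succ]; ring
        rw [Finset.sum_congr rfl this, ← Finset.mul_sum, geom_sum_eq (by norm_num)]
        have h0 : (0:ℝ) ≤ (1/4)^J := by positivity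
        have h1 : 1/4*(((1/4:ℝ)^J-1)/(1/4-1)) = (1-(1/4)^J)/3 := by ring
        rw [h1]; linarith
      nlinarith [Real.exp_pos 32]

lemma sum_two_pow (J : ℕ) : ∑ j ∈ range J, 2^j * (J-j) + J + 2 = 2 * 2^J := by
  induction J with
  | zero => simp
  | succ J ih =>
    rw [Finset.sum_range_succ]
    have e : ∑ j ∈ range J, 2^j * (J+1-j) = ∑ j ∈ range J, 2^j * (J-j) + ∑ j ∈ range J, 2^j := by
      rw [← Finset.sum_add_distrib]
      refine Finset.sum_congr rfl fun j hj => ?_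
      simp only [mem_range] at hj
      rw [show J+1-j = (J-j)+1 by omega]; ring
    have e2 := Nat.geomSum_eq (m := 2) le_rfl J
    have e3 : 1 ≤ 2^J := Nat.one_le_two_pow
    rw [e, e2, show J+1-J = 1 by omega, pow_succ]
    simp only [Nat.add_one_sub_one, Nat.div_one]
    have : (2^J - 1)/(2-1) = 2^J - 1 := by simp
    omega

lemma err_bound (J : ℕ) : ∏ j : Fin J, (1 + 2 * ((block j).card:ℝ))^(2 * (J - (j:ℕ))) ≤ 2^(16 * 2^J) := by
  have h1 : ∀ j : Fin J, (1 + 2 * ((block j).card:ℝ))^(2 * (J - (j:ℕ))) ≤ 2^(8 * (2^(j:ℕ) * (J - (j:ℕ)))) := by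
    intro j
    have hc : (block j).card + 1 ≤ 2^2^((j:ℕ)+1) := by
      have : (block j).card ≤ 2^2^((j:ℕ)+1) - 2^2^(j:ℕ) := by
        rw [block]; refine (Finset.card_filter_le _ _).trans ?_; simp
      have h : 1 ≤ 2^2^(j:ℕ) := Nat.one_le_two_pow
      have h' : 2^2^(j:ℕ) ≤ 2^2^((j:ℕ)+1) := Nat.pow_le_pow_right (by norm_num) (Nat.pow_le_pow_right (by norm_num) (by omega))
      omega
    have hc2 : 1 + 2 * (block j).card ≤ 2^(4 * 2^(j:ℕ)) := by
      have : 2^(4 * 2^(j:ℕ)) = 2^2^((j:ℕ)+1) * 2^2^((j:ℕ)+1) := by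
        rw [← pow_add]; congr 1; ring
      rw [this]
      have h : 2 ≤ 2^2^((j:ℕ)+1) := by
        calc 2 = 2^1 := rfl
          _ ≤ _ := Nat.pow_le_pow_right (by norm_num) Nat.one_le_two_pow
      nlinarith
    have hc3 : 1 + 2 * ((block j).card:ℝ) ≤ 2^(4 * 2^(j:ℕ)) := by exact_mod_cast hc2
    calc _ ≤ ((2:ℝ)^(4 * 2^(j:ℕ)))^(2 * (J - (j:ℕ))) := by gcongr
      _ = _ := by rw [← pow_mul]; congr 1; ring
  refine (Finset.prod_le_prod (fun _ _ => by positivity) fun j _ => h1 j).trans ?_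
  rw [Finset.prod_pow_eq_pow_sum, ← Finset.mul_sum, Fin.sum_univ_eq_sum_range (fun j => 2^j * (J-j)) J]
  refine pow_le_pow_right₀ (by norm_num) ?_
  have := sum_two_pow J
  omega

end CG


namespace CG
open Finset

lemma mertens (N : ℕ) (hN : 1 ≤ N) : Real.log N ≤ ∏ p ∈ N.primesBelow, (1 - (1/(p:ℝ)))⁻¹ := by
  let f : ℕ →* ℝ := 
    { toFun := fun n => 1/(n:ℝ)
      map_one' := by simp
      map_mul' := by intro a b; simp [mul_comm] }
  have hf : ∀ n, f n = 1/(n:ℝ) := fun _ => rfl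
  have h := EulerProduct.summable_and_hasSum_smoothNumbers_prod_primesBelow_geometric (f := f) (by
    intro p hp
    rw [hf, Real.norm_of_nonneg (by positivity), div_lt_one (by exact_mod_cast hp.pos)]
    exact_mod_cast hp.one_lt) N
  obtain ⟨-, h2⟩ := h
  simp only [hf] at h2
  obtain ⟨k, rfl⟩ : ∃ k, N = k + 1 := ⟨N-1, by omega⟩
  have h3 := log_add_one_le_harmonic k
  refine h3.trans ?_
  let φ : ℕ → (k+1).smoothNumbers := fun i => if h : i < k then ⟨i+1, Nat.mem_smoothNumbers_of_lt (by omega) (by omega)⟩ else ⟨1, by simp [Nat.mem_smoothNumbers]⟩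
  have hφ : ∀ i, i < k → ((φ i : ℕ)) = i + 1 := by intro i hi; simp [φ, hi]
  have h4 : ((harmonic k : ℚ) : ℝ) = ∑ m ∈ (range k).image φ, 1/((m:ℕ):ℝ) := by
    rw [Finset.sum_image]
    · rw [harmonic]; push_cast
      refine Finset.sum_congr rfl fun i hi => ?_
      rw [hφ i (by simpa using hi)]; push_cast; simp
    · intro a ha b hb hab
      have : (φ a : ℕ) = φ b := congrArg (fun x : (k+1).smoothNumbers => (x:ℕ)) hab
      rw [hφ a (by simpa using ha), hφ b (by simpa using hb)] at this
      omega
  rw [h4]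
  exact sum_le_hasSum _ (fun _ _ => by positivity) h2

noncomputable def Sdiv (r : ℕ) : ℝ := ∑ d ∈ r.divisors, 1/(d:ℝ)

lemma prod_tele (N : ℕ) : (1/2 : ℝ) ≤ ∏ n ∈ Ico 2 (N+2), (1 - 1/(n:ℝ)^2) := by
  have : ∏ n ∈ Ico 2 (N+2), (1 - 1/(n:ℝ)^2) = ((N:ℝ)+2)/(2*(N+1)) := by
    induction N with
    | zero => norm_num
    | succ N ih =>
      rw [Finset.prod_Ico_succ_top (by omega), ih]
      push_cast
      field_simp
      ring
  rw [this, div_le_div_iff₀ (by norm_num) (by positivity)]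
  linarith

lemma prod_primeFactors_le (r : ℕ) (hr : r ≠ 0) :
    ∏ p ∈ r.primeFactors, (1 - 1/(p:ℝ))⁻¹ ≤ 2 * Sdiv r := by
  have h1 : ∏ p ∈ r.primeFactors, (1 + 1/(p:ℝ)) ≤ Sdiv r := by
    rw [Finset.prod_one_add, Sdiv]
    have : ∑ t ∈ r.primeFactors.powerset, ∏ i ∈ t, 1/(i:ℝ) =
        ∑ d ∈ r.primeFactors.powerset.image (fun t => ∏ i ∈ t, i), 1/(d:ℝ) := by
      rw [Finset.sum_image]
      · refine Finset.sum_congr rfl fun t _ => ?_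
        push_cast; simp
      · intro a ha b hb hab
        simp only [coe_powerset, Set.mem_preimage, Set.mem_powerset_iff, coe_subset] at ha hb
        have e1 := Nat.primeFactors_prod (s := a) fun p hp => Nat.prime_of_mem_primeFactors (ha hp)
        have e2 := Nat.primeFactors_prod (s := b) fun p hp => Nat.prime_of_mem_primeFactors (hb hp)
        simp only at hab
        rw [← e1, ← e2, hab]
    rw [this]
    refine Finset.sum_le_sum_of_subset_of_nonneg ?_ (fun _ _ _ => by positivity)
    intro d hd
    simp only [mem_image, mem_powerset] at hd
    obtain ⟨t, ht, rfl⟩ := hd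
    rw [Nat.mem_divisors]
    refine ⟨?_, hr⟩
    exact Finset.prod_primes_dvd r (fun p hp => (Nat.prime_of_mem_primeFactors (ht hp)).prime)
      fun p hp => Nat.dvd_of_mem_primeFactors (ht hp)
  have h2 : (1/2:ℝ) ≤ ∏ p ∈ r.primeFactors, (1 - 1/(p:ℝ)^2) := by
    refine (prod_tele r).trans ?_
    refine Finset.prod_le_prod_of_subset_of_le_one ?_ ?_ ?_
    · intro p hp
      have := (Nat.prime_of_mem_primeFactors hp).two_le
      have := Nat.le_of_mem_primeFactors hp
      simp; omega
    · intro n hn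
      simp only [mem_Ico] at hn
      have : (2:ℝ) ≤ n := by exact_mod_cast hn.1
      rw [sub_nonneg, div_le_one (by positivity)]; nlinarith
    · intro n _ _
      have : 0 ≤ 1/(n:ℝ)^2 := by positivity
      linarith
  have h3 : ∏ p ∈ r.primeFactors, (1 - 1/(p:ℝ)^2) = (∏ p ∈ r.primeFactors, (1 - 1/(p:ℝ))) * ∏ p ∈ r.primeFactors, (1 + 1/(p:ℝ)) := by
    rw [← Finset.prod_mul_distrib]
    refine Finset.prod_congr rfl fun p _ => ?_
    ring
  have h4 : 0 < ∏ p ∈ r.primeFactors, (1 - 1/(p:ℝ)) := by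
    refine Finset.prod_pos fun p hp => ?_
    have : (1:ℝ) < p := by exact_mod_cast (Nat.prime_of_mem_primeFactors hp).one_lt
    rw [sub_pos, div_lt_one (by linarith)]; exact this
  rw [Finset.prod_inv_distrib, inv_le_iff_one_le_mul₀ h4]
  rw [h3] at h2
  nlinarith

lemma V_bound (r J : ℕ) (hr : r ≠ 0) :
    ∏ j : Fin J, ∏ p ∈ block j, (1 - gfun r p) ≤ 32 * Sdiv r / (2^J)^2 := by
  classical
  set B := (Finset.univ : Finset (Fin J)).biUnion (fun j => block j) with hB
  have hmem : ∀ p ∈ B, p.Prime ∧ 3 ≤ p ∧ p ≤ 2^2^J := by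
    intro p hp
    simp only [hB, mem_biUnion, mem_univ, true_and] at hp
    obtain ⟨j, hj⟩ := hp
    refine ⟨(mem_block.mp hj).2, three_le_of_mem_block hj, (mem_block.mp hj).1.2.trans ?_⟩
    exact Nat.pow_le_pow_right (by norm_num) (Nat.pow_le_pow_right (by norm_num) j.2)
  have hmem' : ∀ p : ℕ, p.Prime → 3 ≤ p → p ≤ 2^2^J → p ∈ B := by
    intro p hp h3 hpJ
    simp only [hB, mem_biUnion, mem_univ, true_and]
    have hex : ∃ j, p ≤ 2^2^j := ⟨J, hpJ⟩
    have hf := Nat.find_spec hex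
    have h0 : Nat.find hex ≠ 0 := by
      intro h; rw [h] at hf; norm_num at hf; omega
    have hJ : Nat.find hex ≤ J := Nat.find_min' hex hpJ
    refine ⟨⟨Nat.find hex - 1, by omega⟩, ?_⟩
    rw [mem_block]
    simp only
    rw [show Nat.find hex - 1 + 1 = Nat.find hex by omega]
    refine ⟨⟨?_, hf⟩, hp⟩
    have := Nat.find_min hex (m := Nat.find hex - 1) (by omega)
    omega
  have hdis : Set.PairwiseDisjoint (↑(Finset.univ : Finset (Fin J))) (fun j : Fin J => block j) := by
    intro i _ j _ hij
    exact block_disjoint (fun h => hij (Fin.ext h))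
  rw [← Finset.prod_biUnion hdis, ← hB]
  have hone : ∀ p : ℕ, p.Prime → 0 < 1 - 1/(p:ℝ) := by
    intro p hp
    have : (1:ℝ) < p := by exact_mod_cast hp.one_lt
    rw [sub_pos, div_lt_one (by linarith)]; exact this
  have hle1 : ∀ p : ℕ, p.Prime → 1 ≤ (1 - 1/(p:ℝ))⁻¹ := by
    intro p hp
    refine (one_le_inv₀ (hone p hp)).mpr ?_
    have : 0 ≤ 1/(p:ℝ) := by positivity
    linarith
  have step : ∏ p ∈ B, (1 - gfun r p) ≤ ∏ p ∈ B, ((1 - 1/(p:ℝ))^2 * (if p ∣ r then (1 - 1/(p:ℝ))⁻¹ else 1)) := by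
    refine Finset.prod_le_prod ?_ ?_
    · intro p hp
      simp only [hB, mem_biUnion, mem_univ, true_and] at hp
      obtain ⟨j, hj⟩ := hp
      linarith [gfun_le_two_thirds (r := r) hj]
    · intro p hp
      have := hone p (hmem p hp).1
      unfold gfun sfun
      split_ifs
      · rw [pow_two, mul_assoc, mul_inv_cancel₀ this.ne']; simp
      · nlinarith [sq_nonneg (1/(p:ℝ))]
  refine step.trans ?_
  rw [Finset.prod_mul_distrib, Finset.prod_pow]
  have hw : ∏ p ∈ B, (if p ∣ r then (1 - 1/(p:ℝ))⁻¹ else 1) ≤ 2 * Sdiv r := by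
    refine le_trans ?_ (prod_primeFactors_le r hr)
    rw [← Finset.prod_filter]
    refine Finset.prod_le_prod_of_subset_of_one_le ?_ ?_ ?_
    · intro p hp
      simp only [mem_filter] at hp
      exact Nat.mem_primeFactors.mpr ⟨(hmem p hp.1).1, hp.2, hr⟩
    · intro p hp
      simp only [mem_filter] at hp
      exact (zero_le_one.trans (hle1 p (hmem p hp.1).1))
    · intro p hp _
      exact hle1 p (Nat.prime_of_mem_primeFactors hp)
  have hm := mertens (2^2^J + 1) (Nat.le_add_left _ _)
  have hsplit : ∏ p ∈ Nat.primesBelow (2^2^J+1), (1 - (1/(p:ℝ)))⁻¹ ≤ 2 * ∏ p ∈ B, (1 - (1/(p:ℝ)))⁻¹ := by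
    have hsub : Nat.primesBelow (2^2^J+1) ⊆ insert 2 B := by
      intro p hp
      rw [Nat.mem_primesBelow] at hp
      rw [mem_insert]
      by_cases h : p = 2
      · left; exact h
      · right; exact hmem' p hp.2 (by have := hp.2.two_le; omega) (by omega)
    have h2 : 2 ∉ B := by intro h; have := (hmem 2 h).2.1; omega
    refine (Finset.prod_le_prod_of_subset_of_one_le hsub ?_ ?_).trans ?_
    · intro p hp
      exact zero_le_one.trans (hle1 p (Nat.prime_of_mem_primesBelow hp))
    · intro p hp _
      rw [mem_insert] at hp
      rcases hp with rfl | hp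
      · exact hle1 2 Nat.prime_two
      · exact hle1 p (hmem p hp).1
    · rw [Finset.prod_insert h2]; norm_num
  have hlog : (2:ℝ)^J / 2 ≤ Real.log ((2^2^J + 1 : ℕ):ℝ) := by
    have : Real.log ((2:ℝ)^(2^J)) ≤ Real.log ((2^2^J + 1 : ℕ):ℝ) := by
      refine Real.log_le_log (by positivity) ?_
      push_cast; linarith
    rw [Real.log_pow] at this
    push_cast at this ⊢
    have := Real.log_two_gt_d9
    nlinarith [pow_pos (two_pos : (0:ℝ) < 2) J]
  have hBpos : 0 < ∏ p ∈ B, (1 - 1/(p:ℝ)) := Finset.prod_pos fun p hp => hone p (hmem p hp).1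
  have hfin : (2:ℝ)^J / 4 * ∏ p ∈ B, (1 - 1/(p:ℝ)) ≤ 1 := by
    have : (2:ℝ)^J/4 ≤ (∏ p ∈ B, (1 - 1/(p:ℝ)))⁻¹ := by
      rw [← Finset.prod_inv_distrib]; linarith
    calc _ ≤ (∏ p ∈ B, (1 - 1/(p:ℝ)))⁻¹ * ∏ p ∈ B, (1 - 1/(p:ℝ)) := by gcongr
      _ = 1 := inv_mul_cancel₀ hBpos.ne'
  have hS : 0 ≤ Sdiv r := Finset.sum_nonneg fun _ _ => by positivity
  have hsq : (∏ p ∈ B, (1 - 1/(p:ℝ)))^2 ≤ 16/(2^J)^2 := by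
    rw [le_div_iff₀ (by positivity)]
    have h0 : 0 ≤ (2:ℝ)^J / 4 * ∏ p ∈ B, (1 - 1/(p:ℝ)) := by positivity
    nlinarith
  calc _ ≤ 16/(2^J)^2 * (2 * Sdiv r) := by
        refine mul_le_mul hsq hw ?_ (by positivity)
        refine Finset.prod_nonneg fun p hp => ?_
        split_ifs
        · exact zero_le_one.trans (hle1 p (hmem p hp).1)
        · norm_num
    _ = _ := by ring

/-- The final sieve bound. -/
lemma sieve_bound (r J N : ℕ) (hr : r ≠ 0) (S : Finset ℕ)
    (hS : ∀ n ∈ S, n < N ∧ ∀ p : ℕ, p.Prime → p ≤ 2^2^J → 2 < p → ¬ p ∣ n ∧ ¬ p ∣ r * n + 1) :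
    (S.card : ℝ) ≤
      (32 * Real.exp (Real.exp 32)) * N * Sdiv r / (2^J)^2 + 2^(16 * 2^J) := by
  have h := sieve_general (J := J) r N (fun j => block j) (fun j p hp => (mem_block.mp hp).2)
    (fun i j hij => block_disjoint (fun h => hij (Fin.ext h))) (fun j => J - (j:ℕ))
  have h0 : (S.card : ℝ) ≤
     (((range N).filter (fun n => ∀ j : Fin J, ∀ p ∈ block j, ¬ p ∣ n ∧ ¬ p ∣ r * n + 1)).card : ℝ) := by
    norm_cast
    refine Finset.card_le_card ?_
    intro n hn
    have hn := hS n hn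
    simp only [mem_filter, mem_range]
    refine ⟨hn.1, fun j p hp => hn.2 p (mem_block.mp hp).2 ((mem_block.mp hp).1.2.trans ?_) (three_le_of_mem_block hp)⟩
    exact Nat.pow_le_pow_right (by norm_num) (Nat.pow_le_pow_right (by norm_num) j.2)
  refine h0.trans (h.trans (add_le_add ?_ (err_bound J)))
  have hnn : ∀ j : Fin J, 0 ≤ ∏ p ∈ block j, (1 - gfun r p) := fun j =>
    Finset.prod_nonneg fun p hp => by linarith [gfun_le_two_thirds (r := r) hp]
  have h1 : ∏ j : Fin J, trunc (block j) (2 * (J - (j:ℕ))) (gfun r) ≤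
      (∏ j : Fin J, ∏ p ∈ block j, (1 - gfun r p)) * Real.exp (Real.exp 32) := by
    refine (le_abs_self _).trans ?_
    rw [Finset.abs_prod]
    refine le_trans (Finset.prod_le_prod (fun _ _ => abs_nonneg _) fun j _ => trunc_le r j _) ?_
    · rw [Finset.prod_mul_distrib]
      exact mul_le_mul_of_nonneg_left (prod_corr J) (Finset.prod_nonneg fun j _ => hnn j)
  have h2 := V_bound r J hr
  calc _ ≤ (N:ℝ) * ((32 * Sdiv r / (2^J)^2) * Real.exp (Real.exp 32)) := by
        refine mul_le_mul_of_nonneg_left (h1.trans ?_) (by positivity)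
        exact mul_le_mul_of_nonneg_right h2 (Real.exp_pos _).le
    _ = _ := by ring

end CG


namespace CG
open Finset

lemma Sdiv_nonneg (r : ℕ) : 0 ≤ Sdiv r := Finset.sum_nonneg fun _ _ => by positivity

lemma sum_inv_sq (R : ℕ) : ∑ d ∈ Icc 1 R, 1/(d:ℝ)^2 ≤ 2 := by
  have h := sum_Ioo_inv_sq_le (α := ℝ) 0 (R+1)
  have e : Icc 1 R = Ioo 0 (R+1) := by ext; simp; omega
  rw [e]
  simpa [one_div] using h

lemma sum_Sdiv (R : ℕ) : ∑ r ∈ Icc 1 R, Sdiv r / r ≤ 2 * (1 + Real.log R) := by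
  have h1 : ∀ r ∈ Icc 1 R, Sdiv r / r = ∑ d ∈ Icc 1 R, if d ∣ r then 1/((d:ℝ)*r) else 0 := by
    intro r hr
    simp only [mem_Icc] at hr
    rw [← Finset.sum_filter, Sdiv, Finset.sum_div]
    refine Finset.sum_congr ?_ fun d _ => by rw [div_div]
    ext d
    simp only [Nat.mem_divisors, mem_filter, mem_Icc]
    constructor
    · intro h
      have := Nat.pos_of_dvd_of_pos h.1 (by omega)
      have := Nat.le_of_dvd (by omega) h.1
      exact ⟨⟨by omega, by omega⟩, h.1⟩
    · intro h
      exact ⟨h.2, by omega⟩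
  rw [Finset.sum_congr rfl h1, Finset.sum_comm]
  have hH : ∑ e ∈ Icc 1 R, 1/(e:ℝ) ≤ 1 + Real.log R := by
    have := harmonic_le_one_add_log R
    rw [harmonic_eq_sum_Icc] at this
    push_cast at this
    simpa [one_div] using this
  have hH0 : 0 ≤ ∑ e ∈ Icc 1 R, 1/(e:ℝ) := Finset.sum_nonneg fun _ _ => by positivity
  have h2 : ∀ d ∈ Icc 1 R, (∑ r ∈ Icc 1 R, if d ∣ r then 1/((d:ℝ)*r) else 0) ≤ 1/(d:ℝ)^2 * ∑ e ∈ Icc 1 R, 1/(e:ℝ) := by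
    intro d hd
    simp only [mem_Icc] at hd
    rw [← Finset.sum_filter]
    have hsub : (Icc 1 R).filter (fun r => d ∣ r) ⊆ (Icc 1 R).image (fun e => d * e) := by
      intro r hr
      simp only [mem_filter, mem_Icc] at hr
      obtain ⟨⟨h1, h2⟩, e, rfl⟩ := hr
      simp only [mem_image, mem_Icc]
      refine ⟨e, ⟨Nat.pos_of_ne_zero ?_, ?_⟩, rfl⟩
      · rintro rfl; simp at h1
      · nlinarith
    refine (Finset.sum_le_sum_of_subset_of_nonneg hsub fun _ _ _ => by positivity).trans ?_
    rw [Finset.sum_image (fun a _ b _ hab => Nat.eq_of_mul_eq_mul_left (by omega) hab), Finset.mul_sum]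
    refine Finset.sum_le_sum fun e _ => ?_
    push_cast
    rw [div_mul_div_comm]
    apply le_of_eq; congr 1 <;> ring
  refine (Finset.sum_le_sum h2).trans ?_
  rw [← Finset.sum_mul]
  exact (mul_le_mul_of_nonneg_right (sum_inv_sq R) hH0).trans (by linarith)

lemma bad_decomp (z w p : ℕ) (hp : p.Prime) (hpx : p ≤ z*z*w) (hbig : z * w + 1 < p)
    (hbad : ∀ D, D ∣ p - 1 → z ≤ D → ¬ D ≤ z * w) :
    ∃ r l, p = r * l + 1 ∧ l.Prime ∧ w < l ∧ 1 ≤ r ∧ r < z*z := by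
  have hex : ∃ D, D ∣ p - 1 ∧ z * w < D := ⟨p-1, dvd_rfl, by omega⟩
  classical
  obtain ⟨hD, hDw⟩ := Nat.find_spec hex
  have hmin := fun m => Nat.find_min hex (m := m)
  set D := Nat.find hex
  have hD1 : D ≠ 1 := by
    intro h
    rw [h] at hDw
    have : z * w = 0 := by omega
    rw [mul_assoc, this] at hpx
    omega
  obtain ⟨l, hl, c, hc⟩ := Nat.exists_prime_and_dvd hD1
  have hp1 : 0 < p - 1 := by have := hp.two_le; omega
  have hDpos : 0 < D := by omega
  have hcpos : 0 < c := Nat.pos_of_ne_zero (by rintro rfl; omega)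
  have hcD : c < D := by
    have := hl.two_le
    rw [hc]; nlinarith
  have hcdvd : c ∣ p - 1 := (Dvd.intro_left l hc.symm).trans hD
  have hcw : c ≤ z * w := by
    by_contra h
    exact hmin c hcD ⟨hcdvd, by omega⟩
  have hcz : c < z := by
    by_contra h
    exact hbad c hcdvd (by omega) hcw
  have hlw : w < l := by
    by_contra h
    have : D ≤ z * w := by
      rw [hc, mul_comm]; exact Nat.mul_le_mul hcz.le (by omega)
    omega
  obtain ⟨r, hr⟩ : l ∣ p - 1 := (Dvd.intro c hc.symm).trans hD
  have hrpos : 1 ≤ r := Nat.pos_of_ne_zero (by rintro rfl; omega)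
  refine ⟨r, l, by rw [mul_comm]; omega, hl, hlw, hrpos, ?_⟩
  by_contra h
  have : z * z * w ≤ r * l := Nat.mul_le_mul (by omega) hlw.le
  rw [mul_comm l r] at hr
  omega

lemma bad_bound (J z w : ℕ) (hz : 1 ≤ z) (hw : 2^2^J ≤ w) (B : Finset ℕ)
    (hB : ∀ p ∈ B, p.Prime ∧ p ≤ z*z*w ∧ ∀ D, D ∣ p - 1 → z ≤ D → ¬ D ≤ z * w) :
    (B.card : ℝ) ≤ z * w + 2 +
      ((32 * Real.exp (Real.exp 32)) * (2 * (z*z*w)) / (2^J)^2 * (2 * (1 + Real.log (z*z))) +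
        z * z * 2^(16 * 2^J)) := by
  classical
  set S : ℕ → Finset ℕ := fun r => (range (z*z*w/r+1)).filter (fun l => l.Prime ∧ w < l ∧ (r*l+1).Prime) with hS
  have hw1 : 1 ≤ w := Nat.one_le_two_pow.trans hw
  have hsub : B ⊆ range (z*w+2) ∪ (Icc 1 (z*z)).biUnion (fun r => (S r).image (fun l => r*l+1)) := by
    intro p hp
    obtain ⟨h1, h2, h3⟩ := hB p hp
    rw [mem_union]
    by_cases hbig : z * w + 1 < p
    · right
      obtain ⟨r, l, rfl, hl, hwl, hr1, hr2⟩ := bad_decomp z w p h1 h2 hbig h3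
      simp only [mem_biUnion, mem_Icc, mem_image]
      refine ⟨r, ⟨hr1, hr2.le⟩, l, ?_, rfl⟩
      simp only [hS, mem_filter, mem_range]
      refine ⟨?_, hl, hwl, h1⟩
      rw [Nat.lt_succ_iff, Nat.le_div_iff_mul_le (by omega), mul_comm]
      omega
    · left; rw [mem_range]; omega
  have hc : B.card ≤ (z*w+2) + ∑ r ∈ Icc 1 (z*z), (S r).card := by
    refine (Finset.card_le_card hsub).trans ((Finset.card_union_le _ _).trans ?_)
    rw [card_range]
    refine Nat.add_le_add_left (Finset.card_biUnion_le.trans ?_) _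
    exact Finset.sum_le_sum fun r _ => Finset.card_image_le
  have hSr : ∀ r ∈ Icc 1 (z*z), ((S r).card : ℝ) ≤ (32 * Real.exp (Real.exp 32)) * (2 * (z*z*w)) / (2^J)^2 * (Sdiv r / r) + 2^(16 * 2^J) := by
    intro r hr
    simp only [mem_Icc] at hr
    have h := sieve_bound r J (z*z*w/r+1) (by omega) (S r) (by
      intro l hl
      simp only [hS, mem_filter, mem_range] at hl
      obtain ⟨h1, h2, h3, h4⟩ := hl
      refine ⟨h1, fun p hp hpJ hp2 => ⟨?_, ?_⟩⟩
      · intro hd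
        have := (Nat.prime_dvd_prime_iff_eq hp h2).mp hd
        omega
      · intro hd
        have := (Nat.prime_dvd_prime_iff_eq hp h4).mp hd
        have : l ≤ r * l := Nat.le_mul_of_pos_left l (by omega)
        omega)
    refine h.trans (add_le_add ?_ le_rfl)
    have hN : ((z*z*w/r+1 : ℕ):ℝ) ≤ 2 * (z*z*w) / r := by
      have hr0 : (0:ℝ) < r := by exact_mod_cast hr.1
      rw [le_div_iff₀ hr0]
      have e1 : z*z*w/r*r ≤ z*z*w := Nat.div_mul_le_self _ _
      have e2 : r ≤ z*z*w := hr.2.trans (Nat.le_mul_of_pos_right _ hw1)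
      have : (z*z*w/r+1)*r ≤ 2*(z*z*w) := by rw [add_mul]; omega
      exact_mod_cast this
    calc _ = (32 * Real.exp (Real.exp 32)) * Sdiv r / (2^J)^2 * ((z*z*w/r+1 : ℕ):ℝ) := by ring
      _ ≤ (32 * Real.exp (Real.exp 32)) * Sdiv r / (2^J)^2 * (2 * (z*z*w) / r) := by
        refine mul_le_mul_of_nonneg_left hN ?_
        have := Sdiv_nonneg r
        positivity
      _ = _ := by ring
  have hc' : (B.card:ℝ) ≤ (z*w+2) + ∑ r ∈ Icc 1 (z*z), ((S r).card:ℝ) := by exact_mod_cast hc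
  refine hc'.trans (add_le_add le_rfl ((Finset.sum_le_sum hSr).trans ?_))
  rw [Finset.sum_add_distrib, ← Finset.mul_sum]
  have h1 := sum_Sdiv (z*z)
  push_cast at h1
  refine add_le_add (mul_le_mul_of_nonneg_left h1 (by positivity)) ?_
  simp

set_option maxHeartbeats 2000000 in
lemma nt_aux (s J : ℕ) (C : ℝ) (hC : 32 * Real.exp (Real.exp 32) ≤ C) (hs : 24 * C * 512 ≤ 2^s)
    (hJ : 2048 * 2^s * 2^J ≤ 2^2^J) :
    ∃ q : ℕ, 2^2^J ≤ q ∧ ∃ P : Finset ℕ, (∀ p ∈ P, p.Prime ∧ p ≤ 2^(32 * 2^(J+s)) ∧ q ∣ p - 1) ∧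
      2^2^J ≤ 128 * 2^(J+s) * P.card := by
  classical
  set z := 2^2^J with hz
  set T := 2^(J+s) with hT
  have hT1 : 1 ≤ T := Nat.one_le_two_pow
  have hz1 : 1 ≤ z := Nat.one_le_two_pow
  have hTs : 2^J ≤ T := Nat.pow_le_pow_right (by norm_num) (by omega)
  set w := 2^(32 * T - 2 * 2^J) with hw
  have hx : 2^(32*T) = z*z*w := by
    rw [hz, hw, ← pow_add, ← pow_add]; congr 1; omega
  have hwT : 2^2^(J+s) ≤ w := Nat.pow_le_pow_right (by norm_num) (by omega)
  set good := ((Icc 1 (z*z*w)).filter (fun p => p.Prime ∧ ∃ D, D ∣ p - 1 ∧ z ≤ D ∧ D ≤ z * w)) with hgood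
  set bad := ((Icc 1 (z*z*w)).filter (fun p => p.Prime ∧ ¬ ∃ D, D ∣ p - 1 ∧ z ≤ D ∧ D ≤ z * w)) with hbad
  have hb := bad_bound (J+s) z w hz1 hwT bad (by
    intro p hp
    simp only [hbad, mem_filter, mem_Icc] at hp
    exact ⟨hp.2.1, hp.1.2, fun D h1 h2 h3 => hp.2.2 ⟨D, h1, h2, h3⟩⟩)
  have hpi : Nat.primeCounting (z*z*w) ≤ good.card + bad.card := by
    rw [Nat.primeCounting, Nat.primeCounting', Nat.count_eq_card_filter_range]
    refine le_trans (Finset.card_le_card ?_) (Finset.card_union_le _ _)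
    intro p hp
    simp only [mem_filter, mem_range, mem_union, hgood, hbad, mem_Icc] at hp ⊢
    have := hp.2.one_lt
    by_cases h : ∃ D, D ∣ p - 1 ∧ z ≤ D ∧ D ≤ z * w
    · left; exact ⟨by omega, hp.2, h⟩
    · right; exact ⟨by omega, hp.2, h⟩
  have hcheb := Chebyshev.pi_ge (z*z*w)
  set X : ℝ := ((z*z*w : ℕ):ℝ) with hX
  have hXe : X = 2^(32*T) := by rw [hX, ← hx]; push_cast; rfl
  have hT1' : (1:ℝ) ≤ T := by exact_mod_cast hT1
  have hX32 : (2:ℝ)^32 ≤ X := by rw [hXe]; exact pow_le_pow_right₀ (by norm_num) (by omega)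
  have hlogX : Real.log X = 32 * T * Real.log 2 := by rw [hXe, Real.log_pow]; push_cast; ring
  have hl2 := Real.log_two_gt_d9
  have hl2' := Real.log_two_lt_d9
  have hpi2 : X / (64 * T) ≤ (Nat.primeCounting (z*z*w) : ℝ) := by
    refine le_trans ?_ hcheb
    rw [hlogX, div_le_div_iff₀ (by positivity) (by positivity)]
    have : Real.log (X+1) ≤ X * Real.log 2 / 2 := by
      have h1 : X + 1 ≤ X * X := by nlinarith
      have h2 : Real.log (X+1) ≤ 2 * Real.log X := by
        rw [← Real.log_rpow (by linarith)]
        refine Real.log_le_log (by linarith) ?_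
        norm_cast
        push_cast
        nlinarith
      have h3 : Real.log X ≤ X * Real.log 2 / 4 := by
        rw [hlogX, hXe]
        have h4 : (T:ℝ) ≤ 2^T := by exact_mod_cast Nat.lt_two_pow_self.le
        have h5 : (2:ℝ)^(32*T) = 2^T * 2^(31*T) := by rw [← pow_add]; congr 1; ring
        have h6 : (2:ℝ)^31 ≤ 2^(31*T) := pow_le_pow_right₀ (by norm_num) (by omega)
        have h7 : (128:ℝ) * T ≤ 2^(32*T) := by
          rw [h5]; nlinarith
        nlinarith
      linarith
    have hTp : 0 < (T:ℝ) := by linarith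
    nlinarith [mul_le_mul_of_nonneg_left this (by positivity : 0 ≤ 64 * (T:ℝ))]
  have hXpos : 0 < X := by linarith [pow_pos (two_pos : (0:ℝ)<2) 32]
  have hzr : (z:ℝ) * z * w = X := by rw [hX]; push_cast; ring
  have hzpos : (0:ℝ) < z := by exact_mod_cast hz1
  have hw1 : (1:ℝ) ≤ w := by exact_mod_cast Nat.one_le_two_pow.trans hwT
  have hJ' : 2048 * (T:ℝ) ≤ z := by
    have : 2048 * T ≤ z := by rw [hT, pow_add]; linarith
    exact_mod_cast this
  have b1 : (z:ℝ) * w + 2 ≤ X / (512 * T) := by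
    rw [le_div_iff₀ (by positivity), ← hzr]
    have h1 : (z:ℝ) * w + 2 ≤ 3 * (z * w) := by nlinarith
    calc ((z:ℝ) * w + 2) * (512 * T) ≤ 3 * (z * w) * (512 * T) := by gcongr
      _ = z * w * (1536 * T) := by ring
      _ ≤ z * w * z := by gcongr; linarith
      _ = _ := by ring
  have b3 : (z:ℝ) * z * 2^(16*2^(J+s)) ≤ X / (512 * T) := by
    rw [le_div_iff₀ (by positivity), hXe]
    have h1 : (z:ℝ) ≤ 2^T := by
      rw [hz]; push_cast; exact pow_le_pow_right₀ (by norm_num) hTs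
    have h4 : (T:ℝ) ≤ 2^T := by exact_mod_cast Nat.lt_two_pow_self.le
    have h5 : (512:ℝ) ≤ 2^(9*T) := by
      calc (512:ℝ) = 2^9 := by norm_num
        _ ≤ _ := pow_le_pow_right₀ (by norm_num) (by omega)
    calc (z:ℝ) * z * 2^(16*2^(J+s)) * (512 * T) ≤ 2^T * 2^T * 2^(16*T) * (2^(9*T) * 2^T) := by gcongr
      _ = 2^(28*T) := by rw [← pow_add, ← pow_add, ← pow_add, ← pow_add]; congr 1; ring
      _ ≤ _ := pow_le_pow_right₀ (by norm_num) (by omega)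
  have b2 : (32 * Real.exp (Real.exp 32)) * (2 * (z*z*w)) / (2^(J+s))^2 * (2 * (1 + Real.log (z*z))) ≤ X / (512 * T) := by
    have hlz : 1 + Real.log ((z:ℝ)*z) ≤ 3 * 2^J := by
      rw [Real.log_mul hzpos.ne' hzpos.ne', hz]; push_cast
      rw [Real.log_pow]; push_cast
      have : (1:ℝ) ≤ 2^J := one_le_pow₀ (by norm_num)
      nlinarith
    have hTr : (2:ℝ)^(J+s) = T := by rw [hT]; push_cast; rfl
    have hC0 : 0 < 32 * Real.exp (Real.exp 32) := by positivity
    have hCpos : 0 < C := by linarith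
    have hzz : 0 ≤ Real.log ((z:ℝ)*z) := Real.log_nonneg (by
      have : (1:ℝ) ≤ z := by exact_mod_cast hz1
      nlinarith)
    rw [hzr, hTr]
    calc _ ≤ C * (2 * X) / (T:ℝ)^2 * (2 * (3 * 2^J)) := by gcongr
      _ ≤ _ := by
        rw [le_div_iff₀ (by positivity), div_mul_eq_mul_div, div_mul_eq_mul_div, div_le_iff₀ (by positivity)]
        have e : (T:ℝ) = 2^J * 2^s := by rw [← hTr, pow_add]
        have hp : (0:ℝ) < 2^J := by positivity
        calc C * (2 * X) * (2 * (3 * 2^J)) * (512 * T) = (12 * C * 512) * (2^J * (T * X)) := by ring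
          _ ≤ 2^s * (2^J * (T * X)) := by gcongr; linarith
          _ = X * ((2^J * 2^s) * T) := by ring
          _ = X * T^2 := by rw [← e]; ring
  have hbadle : (bad.card:ℝ) ≤ 3 * (X / (512 * T)) := by linarith
  have hgoodge : X / (128 * T) ≤ good.card := by
    have : (Nat.primeCounting (z*z*w) : ℝ) ≤ good.card + bad.card := by exact_mod_cast hpi
    have e1 : X / (64 * T) = 8 * (X/(512*T)) := by field_simp; norm_num
    have e2 : X / (128 * T) = 4 * (X/(512*T)) := by field_simp; norm_num
    have : 0 < X/(512*T) := by positivity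
    linarith
  -- pigeonhole
  have hpig : good ⊆ (Icc z (z*w)).biUnion (fun q => good.filter (fun p => q ∣ p - 1)) := by
    intro p hp
    have hp' := hp
    simp only [hgood, mem_filter] at hp
    obtain ⟨-, -, D, hD1, hD2, hD3⟩ := hp
    simp only [mem_biUnion, mem_Icc]
    exact ⟨D, ⟨hD2, hD3⟩, mem_filter.mpr ⟨hp', hD1⟩⟩
  by_contra hcon
  push Not at hcon
  have hle : ∀ q ∈ Icc z (z*w), 128 * (T:ℝ) * ((good.filter (fun p => q ∣ p - 1)).card:ℝ) < z := by
    intro q hq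
    have := hcon q (mem_Icc.mp hq).1 (good.filter (fun p => q ∣ p - 1)) (by
      intro p hp
      simp only [hgood, mem_filter, mem_Icc] at hp
      exact ⟨hp.1.2.1, by rw [hx]; exact hp.1.1.2, hp.2⟩)
    exact_mod_cast this
  have h1 : (good.card:ℝ) ≤ ∑ q ∈ Icc z (z*w), ((good.filter (fun p => q ∣ p - 1)).card:ℝ) := by
    exact_mod_cast (Finset.card_le_card hpig).trans Finset.card_biUnion_le
  have hw1n : 1 ≤ w := Nat.one_le_two_pow.trans hwT
  have hne : (Icc z (z*w)).Nonempty := ⟨z, mem_Icc.mpr ⟨le_rfl, Nat.le_mul_of_pos_right _ hw1n⟩⟩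
  have h2 := Finset.sum_lt_sum_of_nonempty hne hle
  rw [← Finset.mul_sum, Finset.sum_const, nsmul_eq_mul] at h2
  have h3 : ((Icc z (z*w)).card:ℝ) ≤ z * w := by
    rw [Nat.card_Icc]
    have : z*w+1-z ≤ z*w := by omega
    exact_mod_cast this
  rw [div_le_iff₀ (by positivity), ← hzr] at hgoodge
  have h4 : ((Icc z (z*w)).card:ℝ) * z ≤ z * w * z := by gcongr
  have h5 : 128 * (T:ℝ) * good.card ≤ 128 * (T:ℝ) * ∑ q ∈ Icc z (z*w), ((good.filter (fun p => q ∣ p - 1)).card:ℝ) := by gcongr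
  nlinarith

lemma nt_main : ∃ A J0 : ℕ, 0 < A ∧ ∀ J, J0 ≤ J → ∃ q : ℕ, 2^2^J ≤ q ∧ ∃ P : Finset ℕ,
    P.card = 2^2^J ∧ ∀ p ∈ P, p.Prime ∧ p ≤ 2^(A * 2^J) ∧ q ∣ p - 1 := by
  obtain ⟨s, hs⟩ := pow_unbounded_of_one_lt (24 * (32 * Real.exp (Real.exp 32)) * 512) (one_lt_two : (1:ℝ) < 2)
  refine ⟨64 * 2^s, s + 12, by positivity, fun J hJ => ?_⟩
  have h2 : J + s + 12 ≤ 2^J := by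
    obtain ⟨k, rfl⟩ : ∃ k, J = k + 1 := ⟨J-1, by omega⟩
    have : k < 2^k := Nat.lt_two_pow_self
    rw [pow_succ]; omega
  have hsq : 2^2^(J+1) = 2^2^J * 2^2^J := by rw [← pow_add]; congr 1; ring
  have h1 : 2048 * 2^s * 2^(J+1) ≤ 2^2^(J+1) := by
    calc 2048 * 2^s * 2^(J+1) = 2^(J+s+12) := by rw [show 2048 = 2^11 by norm_num, ← pow_add, ← pow_add]; congr 1; ring
      _ ≤ _ := Nat.pow_le_pow_right (by norm_num) (by rw [pow_succ]; omega)
  obtain ⟨q, hq, P, hP, hc⟩ := nt_aux s (J+1) _ le_rfl hs.le h1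
  have h3 : 128 * 2^(J+1+s) ≤ 2^2^J := by
    calc 128 * 2^(J+1+s) = 2^(J+s+8) := by rw [show 128 = 2^7 by norm_num, ← pow_add]; congr 1; ring
      _ ≤ _ := Nat.pow_le_pow_right (by norm_num) (by omega)
  have h4 : 2^2^J ≤ P.card := by
    rw [hsq] at hc
    have : 2^2^J * 2^2^J ≤ 2^2^J * P.card := hc.trans (Nat.mul_le_mul_right _ h3)
    exact Nat.le_of_mul_le_mul_left this (by positivity)
  obtain ⟨P', hP', hc'⟩ := Finset.exists_subset_card_eq h4
  refine ⟨q, le_trans (Nat.pow_le_pow_right (by norm_num) (Nat.pow_le_pow_right (by norm_num) (by omega))) hq, P', hc', fun p hp => ?_⟩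
  obtain ⟨a, b, c⟩ := hP p (hP' hp)
  refine ⟨a, b.trans (le_of_eq ?_), c⟩
  congr 1
  rw [pow_add, pow_add]; ring

end CG


namespace CG
open Finset Matrix

def SR1 (R : Type*) [CommRing R] : Prop := ∀ x y : R, IsCoprime x y → ∃ t, IsUnit (x + t * y)

lemma sr1_zmod (M : ℕ) [NeZero M] : SR1 (ZMod M) := by
  intro x y hxy
  set X := x.val with hX
  set Y := y.val with hY
  have hx : x = (X : ZMod M) := (ZMod.natCast_zmod_val x).symm
  have hy : y = (Y : ZMod M) := (ZMod.natCast_zmod_val y).symm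
  set t := ∏ p ∈ M.primeFactors.filter (fun p => ¬ p ∣ X), p with ht
  refine ⟨(t : ZMod M), ?_⟩
  rw [hx, hy, ← Nat.cast_mul, ← Nat.cast_add, ZMod.isUnit_iff_coprime]
  rw [Nat.coprime_iff_isRelPrime] 
  by_contra hcon
  rw [← Nat.coprime_iff_isRelPrime, Nat.Prime.not_coprime_iff_dvd] at hcon
  obtain ⟨p, hp, h1, h2⟩ := hcon
  by_cases hpX : p ∣ X
  · have h3 : p ∣ t * Y := (Nat.dvd_add_right hpX).mp h1
    rcases (Nat.Prime.dvd_mul hp).mp h3 with h | h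
    · rw [ht, Prime.dvd_finsetProd_iff hp.prime] at h
      obtain ⟨q, hq, hpq⟩ := h
      simp only [mem_filter, Nat.mem_primeFactors] at hq
      rw [(Nat.prime_dvd_prime_iff_eq hp hq.1.1).mp hpq] at hpX
      exact hq.2 hpX
    · obtain ⟨a, b, hab⟩ := hxy
      have := congrArg (ZMod.castHom h2 (ZMod p)) hab
      rw [hx, hy] at this
      simp only [map_add, map_mul, map_natCast, map_one] at this
      rw [(ZMod.natCast_eq_zero_iff X p).mpr hpX, (ZMod.natCast_eq_zero_iff Y p).mpr h] at this
      have := Fact.mk hp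
      rw [mul_zero, mul_zero, add_zero] at *
      exact zero_ne_one (by assumption)
  · have : p ∣ t := Finset.dvd_prod_of_mem _ (by
      simp only [mem_filter, Nat.mem_primeFactors]
      exact ⟨⟨hp, h2, NeZero.ne M⟩, hpX⟩)
    exact hpX ((Nat.dvd_add_left (this.mul_right _)).mp h1)

variable {ι : Type*} [Fintype ι] [DecidableEq ι] {R : Type*} [CommRing R]

def Rel (K : Submonoid (Matrix ι ι R)) (g g' : Matrix ι ι R) : Prop :=
  g'.det = g.det ∧ (g' ∈ K → g ∈ K)

lemma Rel.refl (K : Submonoid (Matrix ι ι R)) (g : Matrix ι ι R) : Rel K g g := ⟨rfl, id⟩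

lemma Rel.trans {K : Submonoid (Matrix ι ι R)} {g g' g'' : Matrix ι ι R} (h : Rel K g g') (h' : Rel K g' g'') :
    Rel K g g'' := ⟨h'.1.trans h.1, fun x => h.2 (h'.2 x)⟩

def HasE (K : Submonoid (Matrix ι ι R)) (a : R) : Prop :=
  ∀ i j, i ≠ j → ∀ c, transvection i j (a * c) ∈ K

lemma rel_left {K : Submonoid (Matrix ι ι R)} {a : R} (hK : HasE K a) (g : Matrix ι ι R) {i j : ι} (hij : i ≠ j)
    (c : R) : Rel K g (transvection i j (a * c) * g) := by
  refine ⟨by rw [det_mul, det_transvection_of_ne _ _ hij, one_mul], fun h => ?_⟩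
  have := K.mul_mem (hK i j hij (-c)) h
  rwa [← Matrix.mul_assoc, transvection_mul_transvection_same _ _ hij, mul_neg, neg_add_cancel,
    transvection_zero, Matrix.one_mul] at this

lemma rel_right {K : Submonoid (Matrix ι ι R)} {a : R} (hK : HasE K a) (g : Matrix ι ι R) {i j : ι} (hij : i ≠ j)
    (c : R) : Rel K g (g * transvection i j (a * c)) := by
  refine ⟨by rw [det_mul, det_transvection_of_ne _ _ hij, mul_one], fun h => ?_⟩
  have := K.mul_mem h (hK i j hij (-c))
  rwa [Matrix.mul_assoc, transvection_mul_transvection_same _ _ hij, mul_neg, add_neg_cancel,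
    transvection_zero, Matrix.mul_one] at this

/-- add multiples of rows in S to row i -/
lemma rel_row {K : Submonoid (Matrix ι ι R)} {a : R} (hK : HasE K a) (g : Matrix ι ι R) (i : ι) (S : Finset ι)
    (hi : i ∉ S) (c : ι → R) :
    Rel K g (Matrix.of fun k l => if k = i then g k l + ∑ j ∈ S, a * c j * g j l else g k l) := by
  induction S using Finset.induction_on with
  | empty => convert Rel.refl K g using 1; ext k l; simp
  | insert j S hj ih =>
    have hij : i ≠ j := fun h => hi (h ▸ mem_insert_self _ _)
    refine (ih (fun h => hi (mem_insert_of_mem h))).trans ?_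
    convert rel_left hK _ hij (c j) using 1
    ext k l
    by_cases hk : k = i
    · subst hk
      rw [transvection_mul_apply_same]
      simp only [of_apply, if_true, if_neg hij.symm, Finset.sum_insert hj]
      ring
    · rw [transvection_mul_apply_of_ne _ _ _ _ hk]
      simp [hk]

/-- add multiples of row i to rows in S -/
lemma rel_col {K : Submonoid (Matrix ι ι R)} {a : R} (hK : HasE K a) (g : Matrix ι ι R) (i : ι) (S : Finset ι)
    (hi : i ∉ S) (c : ι → R) :
    Rel K g (Matrix.of fun k l => if k ∈ S then g k l + a * c k * g i l else g k l) := by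
  induction S using Finset.induction_on with
  | empty => convert Rel.refl K g using 1; ext k l; simp
  | insert j S hj ih =>
    have hij : j ≠ i := fun h => hi (h ▸ mem_insert_self _ _)
    have hiS : i ∉ S := fun h => hi (mem_insert_of_mem h)
    refine (ih hiS).trans ?_
    convert rel_left hK _ hij (c j) using 1
    ext k l
    by_cases hk : k = j
    · subst hk
      rw [transvection_mul_apply_same]
      simp [hj, hiS]
    · rw [transvection_mul_apply_of_ne _ _ _ _ hk]
      simp [hk]

/-- add multiples of column i to columns in S -/
lemma rel_col' {K : Submonoid (Matrix ι ι R)} {a : R} (hK : HasE K a) (g : Matrix ι ι R) (i : ι) (S : Finset ι)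
    (hi : i ∉ S) (c : ι → R) :
    Rel K g (Matrix.of fun k l => if l ∈ S then g k l + a * c l * g k i else g k l) := by
  induction S using Finset.induction_on with
  | empty => convert Rel.refl K g using 1; ext k l; simp
  | insert j S hj ih =>
    have hij : i ≠ j := fun h => hi (h ▸ mem_insert_self _ _)
    have hiS : i ∉ S := fun h => hi (mem_insert_of_mem h)
    refine (ih hiS).trans ?_
    convert rel_right hK _ hij (c j) using 1
    ext k l
    by_cases hk : l = j
    · subst hk
      rw [mul_transvection_apply_same]
      simp [hj, hiS]
    · rw [mul_transvection_apply_of_ne _ _ _ _ hk]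
      simp [hk]

/-- Whitehead -/
lemma rel_diag {K : Submonoid (Matrix ι ι R)} {a : R} (hK : HasE K a) (g : Matrix ι ι R) {i j : ι} (hij : i ≠ j)
    (α β t : R) (hα : α = 1 + a * a * t) (hαβ : α * β = 1) :
    Rel K g (Matrix.of fun k l => if k = i then α * g k l else if k = j then β * g k l else g k l) := by
  have h := (((rel_left hK g hij (-β)).trans (rel_left hK _ hij.symm t)).trans
    (rel_left hK _ hij 1)).trans (rel_left hK _ hij.symm (-t*β))
  convert h using 1
  ext k l
  by_cases hk : k = i
  · subst hk
    simp only [transvection_mul_apply_same, transvection_mul_apply_of_ne _ _ _ _ hij, of_apply, if_true,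
      transvection_mul_apply_of_ne _ _ _ _ hij.symm]
    linear_combination (g k l - a * g j l * β)*hα + a * g j l * hαβ
  · by_cases hk' : k = j
    · subst hk'
      simp only [transvection_mul_apply_same, transvection_mul_apply_of_ne _ _ _ _ hij, of_apply, if_true,
        transvection_mul_apply_of_ne _ _ _ _ hij.symm, if_neg hk]
      linear_combination (g k l + a*t*g i l - a*t*β*a*g k l)*hαβ + (-β*g k l - a*t*β*(g i l - a*g k l*β))*hα
    · simp only [transvection_mul_apply_of_ne _ _ _ _ hk, transvection_mul_apply_of_ne _ _ _ _ hk', of_apply,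
        if_neg hk, if_neg hk']

theorem elim (hR : SR1 R) {K : Submonoid (Matrix ι ι R)} {a : R} (hK : HasE K a) (S : Finset ι) :
    ∀ g : Matrix ι ι R, g.det = 1 → (∀ i j, ¬ (i ∈ S ∧ j ∈ S) → g i j = (1 : Matrix ι ι R) i j) →
      (∀ i j, ∃ b, g i j = (1 : Matrix ι ι R) i j + a * a * b) → g ∈ K := by
  induction S using Finset.induction_on with
  | empty =>
    intro g _ h _
    have : g = 1 := by ext i j; exact h i j (by simp)
    rw [this]; exact K.one_mem
  | insert i S hi ih =>
    intro g hdet hS hg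
    by_cases hSe : S = ∅
    · subst hSe
      have hgd : g = Matrix.diagonal (fun k => g k k) := by
        ext k l
        by_cases hkl : k = l
        · subst hkl; simp
        · rw [diagonal_apply_ne _ hkl, hS k l, one_apply_ne hkl]
          simp only [insert_empty_eq, mem_singleton]
          rintro ⟨rfl, rfl⟩; exact hkl rfl
      have : g i i = 1 := by
        rw [hgd, det_diagonal, Finset.prod_eq_single i] at hdet
        · exact hdet
        · intro k _ hk
          rw [hS k k (by simp [hk]), one_apply_eq]
        · simp
      have hg1 : g = 1 := by
        ext k l
        by_cases h : k = i ∧ l = i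
        · rw [h.1, h.2, this, one_apply_eq]
        · exact hS k l (by simpa using h)
      rw [hg1]; exact K.one_mem
    · obtain ⟨j₀, hj₀⟩ := Finset.nonempty_iff_ne_empty.mpr hSe
      have hij₀ : i ≠ j₀ := fun h => hi (h ▸ hj₀)
      choose b hb using hg
      -- step 1
      set y := ∑ k ∈ S, g.adjugate i k * g k i with hy
      have hsum : g.adjugate i i * g i i + y = 1 := by
        have h1 : (g.adjugate * g) i i = 1 := by rw [adjugate_mul, hdet, one_smul, one_apply_eq]
        rw [mul_apply] at h1
        rw [← h1, hy, ← Finset.sum_insert (f := fun k => g.adjugate i k * g k i) hi]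
        refine Finset.sum_subset (Finset.subset_univ _) ?_
        intro k _ hk
        rw [hS k i (by tauto), one_apply_ne, mul_zero]
        rintro rfl; exact hk (mem_insert_self _ _)
      have hcop : IsCoprime (g i i) (a * y) := by
        refine IsCoprime.mul_right ?_ ⟨g.adjugate i i, 1, by rw [one_mul]; exact hsum⟩
        refine ⟨1, - a * b i i, ?_⟩
        rw [hb i i, one_apply_eq]; ring
      obtain ⟨t, ht⟩ := hR _ _ hcop
      have r1 := rel_row hK g i S hi (fun k => t * g.adjugate i k)
      set g1 := (Matrix.of fun k l => if k = i then g k l + ∑ j ∈ S, a * (t * g.adjugate i j) * g j l else g k l) with hg1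
      have hg1i : ∀ l, g1 i l = g i l + ∑ j ∈ S, a * (t * g.adjugate i j) * g j l := fun l => by simp [hg1]
      have hg1n : ∀ k l, k ≠ i → g1 k l = g k l := fun k l hk => by simp [hg1, hk]
      have hu : g1 i i = g i i + t * (a * y) := by
        rw [hg1i, hy, Finset.mul_sum, Finset.mul_sum]
        congr 1
        exact Finset.sum_congr rfl fun _ _ => by ring
      rw [← hu] at ht
      obtain ⟨β, hβ⟩ := ht.exists_right_inv
      obtain ⟨e, he⟩ : ∃ e, g1 i i = 1 + a * a * e := by
        refine ⟨b i i + t * a * ∑ k ∈ S, g.adjugate i k * b k i, ?_⟩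
        have : y = a * a * ∑ k ∈ S, g.adjugate i k * b k i := by
          rw [hy, Finset.mul_sum]
          refine Finset.sum_congr rfl fun k hk => ?_
          rw [hb k i, one_apply_ne (by rintro rfl; exact hi hk)]; ring
        rw [hu, this, hb i i, one_apply_eq]; ring
      have hrow : ∀ l, l ≠ i → ∃ f, g1 i l = a * f := by
        intro l hl
        refine ⟨a * b i l + ∑ j ∈ S, (t * g.adjugate i j) * g j l, ?_⟩
        rw [hg1i, hb i l, one_apply_ne hl.symm, mul_add, Finset.mul_sum]
        rw [zero_add, mul_assoc]
        congr 1
        exact Finset.sum_congr rfl fun _ _ => by ring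
      have hg1out : ∀ k l, ¬ (k ∈ insert i S ∧ l ∈ insert i S) → g1 k l = (1 : Matrix ι ι R) k l := by
        intro k l hkl
        by_cases hk : k = i
        · subst hk
          have hl : l ∉ insert k S := fun h => hkl ⟨mem_insert_self _ _, h⟩
          rw [hg1i, hS k l hkl, Finset.sum_eq_zero, add_zero]
          intro j hj
          rw [hS j l (fun h => hl h.2), one_apply_ne, mul_zero]
          rintro rfl; exact hl (mem_insert_of_mem hj)
        · rw [hg1n k l hk]; exact hS k l hkl
      -- step 2
      have r2 := rel_col hK g1 i S hi (fun k => - a * b k i * β)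
      set g2 := (Matrix.of fun k l => if k ∈ S then g1 k l + a * (- a * b k i * β) * g1 i l else g1 k l) with hg2
      have hg2i : ∀ l, g2 i l = g1 i l := fun l => by simp [hg2, hi]
      have hg2S : ∀ k ∈ S, ∀ l, g2 k l = g k l + a * (- a * b k i * β) * g1 i l := fun k hk l => by
        rw [← hg1n k l (by rintro rfl; exact hi hk)]; simp [hg2, hk]
      have hg2c : ∀ k, k ≠ i → g2 k i = 0 := by
        intro k hk
        by_cases hkS : k ∈ S
        · rw [hg2S k hkS, hb k i, one_apply_ne hk]
          linear_combination (-a*a*b k i)*hβ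
        · have : g2 k i = g1 k i := by simp [hg2, hkS]
          rw [this, hg1out k i (by simp [hk, hkS]), one_apply_ne hk]
      -- step 3
      choose! f hf using hrow
      have r3 := rel_col' hK g2 i S hi (fun l => - β * f l)
      set g3 := (Matrix.of fun k l => if l ∈ S then g2 k l + a * (- β * f l) * g2 k i else g2 k l) with hg3
      have hg3n : ∀ k l, k ≠ i → g3 k l = g2 k l := by
        intro k l hk
        simp [hg3, hg2c k hk]
      have hg3ii : g3 i i = g1 i i := by simp [hg3, hi, hg2i]
      have hg3i : ∀ l, l ≠ i → g3 i l = 0 := by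
        intro l hl
        by_cases hlS : l ∈ S
        · simp only [hg3, of_apply, if_pos hlS, hg2i, hf l hl]
          linear_combination (-a * f l)*hβ
        · simp only [hg3, of_apply, if_neg hlS, hg2i]
          rw [hg1out i l (by simp [hl, hlS]), one_apply_ne hl.symm]
      -- step 4
      have r4 := rel_diag hK g3 hij₀.symm (g1 i i) β e he hβ
      set g4 := (Matrix.of fun k l => if k = j₀ then g1 i i * g3 k l else if k = i then β * g3 k l else g3 k l) with hg4
      have r := ((r1.trans r2).trans r3).trans r4
      have hg4ii : g4 i i = 1 := by
        simp only [hg4, of_apply, if_neg hij₀, if_true, hg3ii]; rw [mul_comm]; exact hβ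
      have hg4il : ∀ l, l ≠ i → g4 i l = 0 := by
        intro l hl
        simp only [hg4, of_apply, if_neg hij₀, if_true, hg3i l hl, mul_zero]
      have hg4ki : ∀ k, k ≠ i → g4 k i = 0 := by
        intro k hk
        simp only [hg4, of_apply, if_neg hk, hg3n k i hk, hg2c k hk, mul_zero, ite_self]
      refine r.2 (ih g4 (r.1.trans hdet) ?_ ?_)
      · intro k l hkl
        by_cases hk : k = i
        · subst hk
          by_cases hl : l = k
          · subst hl; rw [hg4ii, one_apply_eq]
          · rw [hg4il l hl, one_apply_ne (Ne.symm hl)]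
        · by_cases hl : l = i
          · subst hl; rw [hg4ki k hk, one_apply_ne hk]
          · have hout : ¬ (k ∈ insert i S ∧ l ∈ insert i S) := by simpa [hk, hl] using hkl
            have h3 : g3 k l = (1 : Matrix ι ι R) k l := by
              rw [hg3n k l hk]
              by_cases hkS : k ∈ S
              · have hlS : l ∉ S := fun h => hkl ⟨hkS, h⟩
                rw [hg2S k hkS, hS k l hout, hg1out i l (by simp [hl, hlS]), one_apply_ne (Ne.symm hl), mul_zero, add_zero]
              · have : g2 k l = g1 k l := by simp [hg2, hkS]
                rw [this, hg1out k l hout]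
            simp only [hg4, of_apply, if_neg hk, h3]
            split_ifs with h
            · subst h
              rw [one_apply_ne, mul_zero]
              rintro rfl; exact hkl ⟨hj₀, hj₀⟩
            · rfl
      · intro k l
        by_cases hk : k = i
        · subst hk
          by_cases hl : l = k
          · subst hl; exact ⟨0, by rw [hg4ii, one_apply_eq]; ring⟩
          · exact ⟨0, by rw [hg4il l hl, one_apply_ne (Ne.symm hl)]; ring⟩
        · have h3 : ∃ c, g3 k l = (1 : Matrix ι ι R) k l + a * a * c := by
            rw [hg3n k l hk]
            by_cases hkS : k ∈ S
            · rw [hg2S k hkS, hb k l]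
              exact ⟨b k l - b k i * β * g1 i l, by ring⟩
            · have : g2 k l = g1 k l := by simp [hg2, hkS]
              rw [this, hg1n k l hk]; exact ⟨_, hb k l⟩
          obtain ⟨c, hc⟩ := h3
          simp only [hg4, of_apply, if_neg hk, hc, he]
          split_ifs with h
          · exact ⟨e * (1 : Matrix ι ι R) k l + (1 + a * a * e) * c, by ring⟩
          · exact ⟨c, rfl⟩

end CG


namespace CG
open Finset Matrix

abbrev redSL (d m : ℕ) : SpecialLinearGroup (Fin d) ℤ →* SpecialLinearGroup (Fin d) (ZMod m) :=
  SpecialLinearGroup.map (n := Fin d) (Int.castRingHom (ZMod m))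

def ESL {d : ℕ} (i j : Fin d) (hij : i ≠ j) (c : ℤ) : SpecialLinearGroup (Fin d) ℤ :=
  ⟨transvection i j c, det_transvection_of_ne i j hij c⟩

lemma ESL_add {d : ℕ} (i j : Fin d) (hij : i ≠ j) (c e : ℤ) : ESL i j hij c * ESL i j hij e = ESL i j hij (c + e) := by
  apply Subtype.ext
  exact transvection_mul_transvection_same i j hij c e

lemma ESL_mul_mem {d : ℕ} (H : Subgroup (SpecialLinearGroup (Fin d) ℤ)) (i j : Fin d) (hij : i ≠ j) (c : ℤ)
    (h : ESL i j hij c ∈ H) (e : ℤ) : ESL i j hij (c * e) ∈ H := by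
  have h0 : ESL i j hij 0 = 1 := by
    apply Subtype.ext; exact transvection_zero i j
  have hz : ∀ n : ℤ, ESL i j hij c ^ n = ESL i j hij (c * n) := by
    have hn : ∀ n : ℕ, ESL i j hij c ^ n = ESL i j hij (c * n) := by
      intro n
      induction n with
      | zero => simp [h0]
      | succ n ih => rw [pow_succ, ih, ESL_add]; congr 1; push_cast; ring
    intro n
    cases n with
    | ofNat n => simpa using hn n
    | negSucc n =>
      rw [zpow_negSucc, hn, inv_eq_iff_mul_eq_one, ESL_add, ← h0]
      congr 1
      push_cast [Int.negSucc_eq]; ring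
  rw [← hz]
  exact H.zpow_mem h e

lemma ESL_pow {d : ℕ} (i j : Fin d) (hij : i ≠ j) (n : ℕ) : ESL i j hij 1 ^ n = ESL i j hij n := by
  induction n with
  | zero => apply Subtype.ext; exact (transvection_zero i j).symm
  | succ n ih => rw [pow_succ, ih, ESL_add]; congr 1

/-- the image of a subgroup in matrices -/
def imSub {d : ℕ} (M : ℕ) (H : Subgroup (SpecialLinearGroup (Fin d) ℤ)) : Submonoid (Matrix (Fin d) (Fin d) (ZMod M)) where
  carrier := {A | ∃ h ∈ H, A = (redSL d M h).1}
  one_mem' := ⟨1, H.one_mem, by simp⟩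
  mul_mem' := by
    rintro A B ⟨h, hh, rfl⟩ ⟨k, hk, rfl⟩
    exact ⟨h * k, H.mul_mem hh hk, by rw [map_mul]; rfl⟩

lemma redSL_ESL {d M : ℕ} (i j : Fin d) (hij : i ≠ j) (c : ℤ) :
    (redSL d M (ESL i j hij c)).1 = transvection i j (c : ZMod M) := by
  ext k l
  have : (redSL d M (ESL i j hij c)).1 k l = ((transvection i j c k l : ℤ) : ZMod M) := rfl
  rw [this]
  simp only [transvection, Matrix.add_apply, Matrix.single, Matrix.one_apply, Matrix.of_apply]
  split_ifs <;> simp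

lemma hasE_imSub {d : ℕ} (M : ℕ) [NeZero M] (H : Subgroup (SpecialLinearGroup (Fin d) ℤ)) (a : ℤ)
    (ha : ∀ i j (hij : i ≠ j), ESL i j hij a ∈ H) : HasE (imSub M H) (a : ZMod M) := by
  intro i j hij c
  refine ⟨ESL i j hij (a * (c.val : ℤ)), ESL_mul_mem H i j hij a (ha i j hij) _, ?_⟩
  rw [redSL_ESL]
  push_cast
  simp

theorem redSL_surjective (d M : ℕ) [NeZero M] : Function.Surjective (redSL d M) := by
  intro g
  have hE := hasE_imSub (d := d) M ⊤ 1 (fun _ _ _ => Subgroup.mem_top _)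
  obtain ⟨h, -, hh⟩ := elim (sr1_zmod M) hE Finset.univ g.1 g.2 (by simp) (fun i j => ⟨g.1 i j - (1 : Matrix _ _ _) i j, by simp⟩)
  exact ⟨h, Subtype.ext hh.symm⟩

lemma index_ne_zero_of_cong {d M : ℕ} (hM : 1 ≤ M) (H : Subgroup (SpecialLinearGroup (Fin d) ℤ))
    (h : (redSL d M).ker ≤ H) : H.index ≠ 0 := by
  have : NeZero M := ⟨by omega⟩
  have h1 : (redSL d M).ker.index ≠ 0 := by
    rw [Subgroup.index_ker]
    exact Nat.card_pos.ne'
  intro h0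
  have := Subgroup.index_dvd_of_le h
  rw [h0] at this
  exact h1 (by simpa using this)

theorem level_bound {d M : ℕ} (hM : 1 ≤ M) (H : Subgroup (SpecialLinearGroup (Fin d) ℤ))
    (h : (redSL d M).ker ≤ H) : ∃ m, 1 ≤ m ∧ m ≤ H.index^(2*d^2) ∧ (redSL d m).ker ≤ H := by
  have : NeZero M := ⟨by omega⟩
  have hidx := index_ne_zero_of_cong hM H h
  have hex : ∀ i j : Fin d, ∃ n : ℕ, 0 < n ∧ n ≤ H.index ∧ ∀ hij : i ≠ j, ESL i j hij (n:ℤ) ∈ H := by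
    intro i j
    by_cases hij : i = j
    · exact ⟨1, by omega, by omega, fun h => absurd hij h⟩
    · obtain ⟨n, h1, h2, h3⟩ := Subgroup.exists_pow_mem_of_index_ne_zero hidx (ESL i j hij 1)
      exact ⟨n, h1, h2, fun _ => by rwa [ESL_pow] at h3⟩
  choose f hf0 hf1 hf2 using hex
  set a := ∏ i, ∏ j, f i j with ha
  have ha0 : 1 ≤ a := Finset.one_le_prod' fun i _ => Finset.one_le_prod' fun j _ => hf0 i j
  have hale : a ≤ H.index^(d^2) := by
    calc a ≤ ∏ i : Fin d, ∏ j : Fin d, H.index := Finset.prod_le_prod' fun i _ => Finset.prod_le_prod' fun j _ => hf1 i j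
      _ = _ := by simp [← pow_mul, pow_two]
  refine ⟨a*a, Nat.mul_pos ha0 ha0, ?_, ?_⟩
  · calc a * a ≤ H.index^(d^2) * H.index^(d^2) := Nat.mul_le_mul hale hale
      _ = _ := by rw [← pow_add]; congr 1; ring
  · intro g hg
    have hE := hasE_imSub (d := d) M H a (by
      intro i j hij
      obtain ⟨c, hc⟩ : f i j ∣ a := (Finset.dvd_prod_of_mem (f i) (mem_univ j)).trans (Finset.dvd_prod_of_mem (fun i => ∏ j, f i j) (mem_univ i))
      rw [hc]; push_cast
      exact ESL_mul_mem H i j hij _ (hf2 i j hij) _)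
    rw [MonoidHom.mem_ker] at hg
    obtain ⟨h', hh', he⟩ := elim (sr1_zmod M) hE Finset.univ (redSL d M g).1 (redSL d M g).2 (by simp) (by
      intro i j
      have e1 : ((g.1 i j : ℤ) : ZMod (a*a)) = (((1 : Matrix (Fin d) (Fin d) ℤ) i j : ℤ) : ZMod (a*a)) := by
        have := congrArg (fun A => A.1 i j) hg
        simp only [redSL] at this
        refine Eq.trans this ?_
        by_cases hij : i = j
        · subst hij; simp
        · simp [hij]
      rw [ZMod.intCast_eq_intCast_iff_dvd_sub] at e1
      obtain ⟨c, hc⟩ := e1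
      refine ⟨((-c : ℤ) : ZMod M), ?_⟩
      have e2 : (redSL d M g).1 i j = ((g.1 i j : ℤ) : ZMod M) := rfl
      have e3 : g.1 i j = (1 : Matrix (Fin d) (Fin d) ℤ) i j + a * a * (-c) := by push_cast at hc; linarith
      have e4 : (((1 : Matrix (Fin d) (Fin d) ℤ) i j : ℤ) : ZMod M) = (1 : Matrix _ _ _) i j := by
        by_cases hij : i = j
        · subst hij; simp
        · simp [hij]
      rw [e2, e3]; push_cast; rw [e4])
    have : g * h'⁻¹ ∈ H := h (by
      rw [MonoidHom.mem_ker, map_mul, map_inv, mul_inv_eq_one]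
      exact Subtype.ext he)
    simpa using H.mul_mem this hh'

end CG


namespace CG
open Finset

def GenBy {G : Type*} [Group G] (H : Subgroup G) (k : ℕ) : Prop :=
  ∃ s : Finset G, s.card ≤ k ∧ Subgroup.closure (s : Set G) = H

section
variable {G G' : Type*} [Group G] [Group G']

lemma GenBy.mono {H : Subgroup G} {a b : ℕ} (h : GenBy H a) (hab : a ≤ b) : GenBy H b := by
  obtain ⟨s, h1, h2⟩ := h
  exact ⟨s, h1.trans hab, h2⟩

lemma GenBy.bot (k : ℕ) : GenBy (⊥ : Subgroup G) k := ⟨∅, by simp, by simp⟩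

lemma GenBy.map {H : Subgroup G} {a : ℕ} (h : GenBy H a) (f : G →* G') : GenBy (H.map f) a := by
  classical
  obtain ⟨s, h1, h2⟩ := h
  refine ⟨s.image f, Finset.card_image_le.trans h1, ?_⟩
  rw [Finset.coe_image, ← MonoidHom.map_closure, h2]

lemma GenBy.of_ext {H : Subgroup G} (f : G →* G') {a b : ℕ} (h1 : GenBy (H.map f) a) (h2 : GenBy (H ⊓ f.ker) b) :
    GenBy H (a + b) := by
  classical
  obtain ⟨s, hs, hs'⟩ := h1
  obtain ⟨t, ht, ht'⟩ := h2
  have hlift : ∀ x ∈ s, ∃ y ∈ H, f y = x := by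
    intro x hx
    have : x ∈ H.map f := hs' ▸ Subgroup.subset_closure hx
    exact this
  choose! g hg1 hg2 using hlift
  refine ⟨s.image g ∪ t, ?_, ?_⟩
  · refine (Finset.card_union_le _ _).trans (Nat.add_le_add (Finset.card_image_le.trans hs) ht)
  · set C := Subgroup.closure ((s.image g ∪ t : Finset G) : Set G) with hC
    have hCH : C ≤ H := by
      rw [hC, Subgroup.closure_le]
      intro x hx
      simp only [coe_union, coe_image, Set.mem_union, Set.mem_image, mem_coe] at hx
      rcases hx with ⟨y, hy, rfl⟩ | hx
      · exact hg1 y hy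
      · have : x ∈ H ⊓ f.ker := ht' ▸ Subgroup.subset_closure hx
        exact this.1
    refine le_antisymm hCH ?_
    have hmap : H.map f ≤ C.map f := by
      rw [← hs', Subgroup.closure_le]
      intro x hx
      exact ⟨g x, Subgroup.subset_closure (by simp; exact Or.inl ⟨x, hx, rfl⟩), hg2 x hx⟩
    have hker : H ⊓ f.ker ≤ C := by
      rw [← ht']
      exact Subgroup.closure_mono (by simp)
    intro x hx
    obtain ⟨y, hy, hxy⟩ := hmap ⟨x, hx, rfl⟩
    have : y⁻¹ * x ∈ H ⊓ f.ker := ⟨H.mul_mem (H.inv_mem (hCH hy)) hx, MonoidHom.mem_ker.mpr (by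
      rw [map_mul, map_inv, hxy, inv_mul_cancel])⟩
    simpa using C.mul_mem hy (hker this)

/-- A hereditary class, iterated over a finite family of homs. -/
lemma GenBy.of_family {ι : Type*} {X : ι → Type*} [∀ i, Group (X i)] (f : ∀ i, G →* X i) (c : ℕ)
    (T : Finset ι) : ∀ Q : Subgroup G, (∀ i ∈ T, ∀ Q' ≤ Q, GenBy (Q'.map (f i)) c) →
      (∀ x ∈ Q, (∀ i ∈ T, f i x = 1) → x = 1) → GenBy Q (c * T.card) := by
  classical
  induction T using Finset.induction_on with
  | empty =>
    intro Q _ h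
    have : Q = ⊥ := (Subgroup.eq_bot_iff_forall _).mpr fun x hx => h x hx (by simp)
    rw [this]; exact GenBy.bot _
  | insert i T hi ih =>
    intro Q h1 h2
    rw [Finset.card_insert_of_notMem hi, mul_add, mul_one, add_comm]
    refine GenBy.of_ext (f i) (h1 i (mem_insert_self _ _) Q le_rfl) (ih _ ?_ ?_)
    · intro j hj Q' hQ'
      exact h1 j (mem_insert_of_mem hj) Q' (hQ'.trans inf_le_left)
    · intro x hx hT
      refine h2 x hx.1 fun j hj => ?_
      rcases mem_insert.mp hj with rfl | hj
      · exact hx.2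
      · exact hT j hj

lemma GenBy.of_top {H : Subgroup G} {k : ℕ} (h : GenBy (⊤ : Subgroup H) k) : GenBy H k := by
  have := h.map H.subtype
  rwa [← MonoidHom.range_eq_map, Subgroup.range_subtype] at this

/-- p-group of order dividing p^n -/
lemma GenBy.of_card {p : ℕ} (hp : p.Prime) {H : Subgroup G} [Finite H] {n : ℕ} (hH : Nat.card H ∣ p^n) : GenBy H n := by
  classical
  have key : ∀ k, ∃ s : Finset G, s.card ≤ k ∧ Subgroup.closure (s : Set G) ≤ H ∧
      (Subgroup.closure (s : Set G) = H ∨ p^k ≤ Nat.card (Subgroup.closure (s : Set G))) := by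
    intro k
    induction k with
    | zero => exact ⟨∅, by simp, by simp, Or.inr (by simp)⟩
    | succ k ih =>
      obtain ⟨s, h1, h2, h3⟩ := ih
      by_cases h : Subgroup.closure (s : Set G) = H
      · exact ⟨s, by omega, h2, Or.inl h⟩
      · obtain ⟨x, hx, hxs⟩ := SetLike.exists_of_lt (lt_of_le_of_ne h2 h)
        have h4 := h3.resolve_left h
        set C := Subgroup.closure (s : Set G)
        set C' := Subgroup.closure ((insert x s : Finset G) : Set G)
        have hC' : C' ≤ H := by
          rw [Subgroup.closure_le]
          intro y hy
          simp only [coe_insert, Set.mem_insert_iff, mem_coe] at hy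
          rcases hy with rfl | hy
          · exact hx
          · exact h2 (Subgroup.subset_closure hy)
        have hCC' : C < C' := by
          refine lt_of_le_of_ne (Subgroup.closure_mono (by simp)) ?_
          intro he
          exact hxs (he ▸ Subgroup.subset_closure (by simp))
        refine ⟨insert x s, (Finset.card_insert_le _ _).trans (by omega), hC', Or.inr ?_⟩
        have : Finite C' := Finite.of_injective (Subgroup.inclusion hC') (Subgroup.inclusion_injective hC')
        have : Finite C := Finite.of_injective (Subgroup.inclusion h2) (Subgroup.inclusion_injective h2)
        obtain ⟨a, ha, ha'⟩ := (Nat.dvd_prime_pow hp).mp ((Subgroup.card_dvd_of_le h2).trans hH)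
        obtain ⟨b, hb, hb'⟩ := (Nat.dvd_prime_pow hp).mp ((Subgroup.card_dvd_of_le hC').trans hH)
        have hlt : Nat.card C < Nat.card C' := by
          have := Set.ncard_lt_ncard (SetLike.coe_ssubset_coe.mpr hCC') (Set.toFinite _)
          exact this
        rw [ha', hb'] at hlt
        rw [ha'] at h4
        rw [hb']
        have e1 : a < b := (Nat.pow_lt_pow_iff_right hp.one_lt).mp hlt
        have e2 : k ≤ a := (Nat.pow_le_pow_iff_right hp.one_lt).mp h4
        exact Nat.pow_le_pow_right hp.pos (by omega)
  obtain ⟨s, h1, h2, h3⟩ := key n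
  refine ⟨s, h1, ?_⟩
  rcases h3 with h | h
  · exact h
  · have h5 : Nat.card H ≤ p^n := Nat.le_of_dvd (pow_pos hp.pos n) hH
    exact Subgroup.eq_of_le_of_card_ge h2 (h5.trans h)

lemma GenBy.of_finite [Finite G] (H : Subgroup G) : GenBy H (Nat.card G) := by
  classical
  have := Fintype.ofFinite G
  refine ⟨(H : Set G).toFinset, ?_, by simp⟩
  rw [Nat.card_eq_fintype_card]
  exact Finset.card_le_univ _

end

/-- Counting subgroups via Sylow subgroups. -/
theorem card_subgroup_le {G : Type*} [Group G] [Finite G] (c : ℕ)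
    (hc : ∀ l : ℕ, l.Prime → ∀ Q : Subgroup G, IsPGroup l Q → GenBy Q c) :
    Nat.card (Subgroup G) ≤ Nat.card G ^ ((Nat.card G).primeFactors.card + c) := by
  classical
  set N := Nat.card G with hN
  let L := {l // l ∈ N.primeFactors}
  have hfact : ∀ l : L, Fact l.1.Prime := fun l => ⟨Nat.prime_of_mem_primeFactors l.2⟩
  let P : ∀ l : L, Sylow l.1 G := fun l => default
  let F : (∀ l : L, G × (Fin c → (P l : Subgroup G))) → Subgroup G := fun a =>
    ⨆ l : L, (Subgroup.closure (Set.range fun i => ((a l).2 i : G))).map (MulAut.conj (a l).1).toMonoidHom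
  have hF : Function.Surjective F := by
    intro H
    -- choose Sylow subgroups of H
    have hex : ∀ l : L, ∃ a : G × (Fin c → (P l : Subgroup G)),
        (Subgroup.closure (Set.range fun i => (a.2 i : G))).map (MulAut.conj a.1).toMonoidHom ≤ H ∧
        l.1 ^ (Nat.card H).factorization l.1 ∣ Nat.card ((Subgroup.closure (Set.range fun i => (a.2 i : G))).map (MulAut.conj a.1).toMonoidHom) := by
      intro l
      have := hfact l
      let S : Sylow l.1 H := default
      let S' : Subgroup G := (S : Subgroup H).map H.subtype
      have hS' : IsPGroup l.1 S' := S.2.map _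
      obtain ⟨Q, hQ⟩ := hS'.exists_le_sylow
      obtain ⟨g, hg⟩ := MulAction.exists_smul_eq G (P l) Q
      -- conj back
      let S'' : Subgroup G := S'.map (MulAut.conj g⁻¹).toMonoidHom
      have hS''P : S'' ≤ (P l : Subgroup G) := by
        rintro _ ⟨x, hx, rfl⟩
        have h1 : x ∈ (Q : Subgroup G) := hQ hx
        rw [← hg, Sylow.coe_subgroup_smul] at h1
        rw [Subgroup.mem_pointwise_smul_iff_inv_smul_mem] at h1
        simpa using h1
      have hS''p : IsPGroup l.1 S'' := hS'.map _
      obtain ⟨s, hs1, hs2⟩ := hc l.1 (hfact l).out S'' hS''p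
      have hsub : ∀ x ∈ s, x ∈ (P l : Subgroup G) := fun x hx => hS''P (hs2 ▸ Subgroup.subset_closure hx)
      -- enumerate s by Fin c
      obtain ⟨e, he⟩ : ∃ e : Fin c → (P l : Subgroup G), Subgroup.closure (Set.range fun i => (e i : G)) = S'' := by
        let eq := s.equivFin
        refine ⟨fun i => if h : i.1 < s.card then ⟨(eq.symm ⟨i.1, h⟩).1, hsub _ (eq.symm ⟨i.1, h⟩).2⟩ else 1, ?_⟩
        rw [← hs2]
        apply le_antisymm
        · rw [Subgroup.closure_le]
          rintro _ ⟨i, rfl⟩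
          by_cases h : i.1 < s.card
          · simp only [h, dif_pos]
            exact Subgroup.subset_closure (eq.symm ⟨i.1, h⟩).2
          · simp [h, one_mem]
        · rw [Subgroup.closure_le]
          intro x hx
          refine Subgroup.subset_closure ⟨⟨(eq ⟨x, hx⟩).1, lt_of_lt_of_le (eq ⟨x, hx⟩).2 hs1⟩, ?_⟩
          simp
      have hconj : S''.map (MulAut.conj g).toMonoidHom = S' := by
        ext x
        simp only [S'', Subgroup.mem_map]
        constructor
        · rintro ⟨y, ⟨z, hz, rfl⟩, rfl⟩
          simpa [mul_assoc] using hz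
        · intro hx
          exact ⟨g⁻¹ * x * g, ⟨x, hx, by simp⟩, by simp [mul_assoc]⟩
      refine ⟨(g, e), ?_, ?_⟩
      · simp only [he, hconj]
        rintro _ ⟨x, _, rfl⟩
        exact x.2
      · simp only [he, hconj]
        have h1 : Nat.card S' = Nat.card S := Nat.card_congr (Subgroup.equivMapOfInjective _ _ H.subtype_injective).symm.toEquiv
        rw [h1, Sylow.card_eq_multiplicity]
    choose a ha1 ha2 using hex
    refine ⟨a, ?_⟩
    have hle : F a ≤ H := iSup_le fun l => ha1 l
    refine Subgroup.eq_of_le_of_card_ge hle (Nat.le_of_dvd Nat.card_pos ?_)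
    rw [← Nat.factorization_prime_le_iff_dvd Nat.card_pos.ne' Nat.card_pos.ne']
    intro l hl
    by_cases hlN : l ∈ N.primeFactors
    · have h1 := (ha2 ⟨l, hlN⟩).trans (Subgroup.card_dvd_of_le (le_iSup (fun l : L => (Subgroup.closure (Set.range fun i => ((a l).2 i : G))).map (MulAut.conj (a l).1).toMonoidHom) ⟨l, hlN⟩))
      exact (hl.pow_dvd_iff_le_factorization Nat.card_pos.ne').mp h1
    · rw [Nat.factorization_eq_zero_of_not_dvd]
      · exact Nat.zero_le _
      · intro h
        exact hlN (Nat.mem_primeFactors.mpr ⟨hl, h.trans (Subgroup.card_subgroup_dvd_card H), Nat.card_pos.ne'⟩)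
  have hcard := Nat.card_le_card_of_surjective F hF
  refine hcard.trans (le_of_eq ?_)
  rw [Nat.card_pi]
  simp only [Nat.card_prod, Nat.card_pi, Finset.prod_const, Finset.card_univ, Fintype.card_fin]
  rw [Finset.prod_mul_distrib, Finset.prod_const, Finset.prod_pow, pow_add]
  congr 1
  · simp [L, N]
  · congr 1
    have : ∀ l : L, Nat.card (P l : Subgroup G) = l.1 ^ N.factorization l.1 := fun l => by
      have := hfact l
      exact Sylow.card_eq_multiplicity _
    rw [Finset.prod_congr rfl fun l _ => this l]
    have h2 : N = ∏ l ∈ N.primeFactors, l ^ N.factorization l := (Nat.prod_factorization_pow_eq_self (n := N) Nat.card_pos.ne').symm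
    conv_rhs => rw [h2]
    exact Finset.prod_coe_sort N.primeFactors (fun l => l ^ N.factorization l)

end CG


namespace CG
open Finset

section
variable {G : Type*} [Group G] [Finite G]

lemma exists_central {l : ℕ} (hl : l.Prime) (hG : IsPGroup l G) (N : Subgroup G) [hN : N.Normal]
    (hne : N ≠ ⊥) : ∃ x ∈ N, x ≠ 1 ∧ ∀ g : G, g * x = x * g := by
  have := Fact.mk hl
  have hG' : IsPGroup l (ConjAct G) := hG
  have hNl : IsPGroup l N := hG.to_subgroup N
  obtain ⟨n, hn⟩ := IsPGroup.iff_card.mp hNl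
  have hdvd : l ∣ Nat.card N := by
    rcases Nat.eq_zero_or_pos n with h0 | h0
    · rw [h0, pow_zero] at hn
      exact absurd (Subgroup.card_eq_one.mp hn) hne
    · rw [hn]; exact dvd_pow_self _ h0.ne'
  have h1 : (1 : N) ∈ MulAction.fixedPoints (ConjAct G) N := by
    intro g; exact smul_one g
  obtain ⟨b, hb, hb1⟩ := hG'.exists_fixed_point_of_prime_dvd_card_of_fixed_point N hdvd h1
  refine ⟨b, b.2, fun h => hb1 (Subtype.ext h.symm), fun g => ?_⟩
  have := congrArg Subtype.val (hb (ConjAct.toConjAct g))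
  rw [ConjAct.Subgroup.val_conj_smul, ConjAct.smul_def] at this
  simp only [ConjAct.ofConjAct_toConjAct] at this
  exact mul_inv_eq_iff_eq_mul.mp this

lemma exists_selfcent {l : ℕ} (hl : l.Prime) (hG : IsPGroup l G) :
    ∃ A : Subgroup G, A.Normal ∧ (∀ a ∈ A, ∀ b ∈ A, a * b = b * a) ∧
      ∀ g, (∀ a ∈ A, g * a = a * g) → g ∈ A := by
  classical
  let S : Set (Subgroup G) := {A | A.Normal ∧ (∀ a ∈ A, ∀ b ∈ A, a * b = b * a)}
  have hS : S.Nonempty := ⟨⊥, inferInstance, by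
    intro a ha b hb
    rw [Subgroup.mem_bot] at ha hb
    rw [ha, hb]⟩
  obtain ⟨A, hA⟩ := (Set.toFinite S).exists_maximal hS
  obtain ⟨hAn, hAc⟩ := hA.prop
  refine ⟨A, hAn, hAc, ?_⟩
  by_contra hcon
  push Not at hcon
  obtain ⟨g, hg, hgA⟩ := hcon
  let C : Subgroup G := Subgroup.centralizer (A : Set G)
  have hgC : g ∈ C := by
    rw [Subgroup.mem_centralizer_iff]
    intro a ha; exact (hg a ha).symm
  have hCn : C.Normal := by
    refine ⟨fun n hn x => ?_⟩
    rw [Subgroup.mem_centralizer_iff] at hn ⊢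
    intro a ha
    have h1 := hn (x⁻¹ * a * x) (by simpa using hAn.conj_mem a ha x⁻¹)
    calc a * (x * n * x⁻¹) = x * ((x⁻¹ * a * x) * n) * x⁻¹ := by group
      _ = x * (n * (x⁻¹ * a * x)) * x⁻¹ := by rw [h1]
      _ = _ := by group
  let π := QuotientGroup.mk' A
  have hπ : Function.Surjective π := QuotientGroup.mk'_surjective A
  have hNn : (C.map π).Normal := hCn.map π hπ
  have hne : C.map π ≠ ⊥ := by
    intro h
    have : π g ∈ C.map π := ⟨g, hgC, rfl⟩
    rw [h, Subgroup.mem_bot] at this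
    exact hgA ((QuotientGroup.eq_one_iff g).mp this)
  obtain ⟨y, hyN, hy1, hyc⟩ := exists_central hl (hG.to_quotient A) (C.map π) hne
  obtain ⟨x, hxC, rfl⟩ := hyN
  let B := (Subgroup.zpowers (π x)).comap π
  have hxA : x ∉ A := fun h => hy1 ((QuotientGroup.eq_one_iff x).mpr h)
  have hAB : A ≤ B := by
    intro a ha
    have : π a = 1 := (QuotientGroup.eq_one_iff a).mpr ha
    show π a ∈ Subgroup.zpowers (π x)
    rw [this]; exact one_mem _
  have hxB : x ∈ B := Subgroup.mem_zpowers (π x)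
  have hrep : ∀ b ∈ B, ∃ n : ℤ, ∃ a ∈ A, b = x ^ n * a := by
    intro b hb
    obtain ⟨n, hn⟩ := Subgroup.mem_zpowers_iff.mp (show π b ∈ Subgroup.zpowers (π x) from hb)
    refine ⟨n, (x^n)⁻¹ * b, ?_, by group⟩
    have : π ((x^n)⁻¹ * b) = 1 := by rw [map_mul, map_inv, map_zpow, hn, inv_mul_cancel]
    exact (QuotientGroup.eq_one_iff _).mp this
  have hBS : B ∈ S := by
    constructor
    · refine ⟨fun n hn z => ?_⟩
      show π (z * n * z⁻¹) ∈ Subgroup.zpowers (π x)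
      have hn' : π n ∈ Subgroup.zpowers (π x) := hn
      obtain ⟨k, hk⟩ := Subgroup.mem_zpowers_iff.mp hn'
      have : Commute (π z) (π x ^ k) := Commute.zpow_right (hyc (π z)) k
      rw [map_mul, map_mul, map_inv, ← hk, this.eq, mul_inv_cancel_right]
      exact Subgroup.zpow_mem_zpowers _ _
    · intro b hb c hc
      obtain ⟨n, a, ha, rfl⟩ := hrep b hb
      obtain ⟨m, a', ha', rfl⟩ := hrep c hc
      have hx : ∀ a ∈ A, Commute x a := fun a ha =>
        ((Subgroup.mem_centralizer_iff.mp hxC) a ha).symm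
      have e1 : Commute a a' := hAc a ha a' ha'
      have e2 : Commute (x^n * a) (x^m * a') := by
        apply Commute.mul_left
        · apply Commute.mul_right
          · exact (Commute.refl x).zpow_zpow n m
          · exact (hx a' ha').zpow_left n
        · apply Commute.mul_right
          · exact ((hx a ha).zpow_left m).symm
          · exact e1
      exact e2
  have := hA.le_of_ge hBS hAB
  exact hxA (this hxB)

end

section
variable {K V G : Type*} [Field K] [IsAlgClosed K] [AddCommGroup V] [Module K V]
  [FiniteDimensional K V] [Group G] [Finite G]

lemma isSemisimple_rho {l : ℕ} (hlK : (l : K) ≠ 0) (hG : IsPGroup l G)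
    (ρ : G →* Module.End K V) (g : G) : (ρ g).IsSemisimple := by
  obtain ⟨n, hn⟩ := hG g
  refine Module.End.isSemisimple_of_squarefree_aeval_eq_zero
    (p := Polynomial.X ^ (l^n) - 1) ?_ ?_
  · apply Polynomial.Separable.squarefree
    apply Polynomial.separable_X_pow_sub_C (1:K) _ one_ne_zero
    push_cast
    exact pow_ne_zero _ hlK
  · rw [map_sub, map_pow, Polynomial.aeval_X, map_one, ← map_pow, hn, map_one, sub_self]

theorem ell_rank {l : ℕ} (hl : l.Prime) (hlK : (l : K) ≠ 0) (hG : IsPGroup l G)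
    (ρ : G →* Module.End K V) (hρ : Function.Injective ρ) :
    GenBy (⊤ : Subgroup G) ((Module.finrank K V).factorial + Module.finrank K V) := by
  classical
  obtain ⟨A, hAn, hAc, hAA⟩ := exists_selfcent hl hG
  let W : (A → K) → Submodule K V := fun χ => ⨅ a : A, (ρ a).eigenspace (χ a)
  have hWeq : ∀ χ : A → K, W χ = ⨅ a : A, (ρ a).maxGenEigenspace (χ a) := by
    intro χ
    refine iInf_congr fun a => ?_
    exact ((isSemisimple_rho hlK hG ρ a).isFinitelySemisimple.maxGenEigenspace_eq_eigenspace _).symm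
  have hcomm : ∀ a b : A, Commute (ρ a) (ρ b) := by
    intro a b
    show ρ a * ρ b = ρ b * ρ a
    rw [← map_mul, ← map_mul, hAc a a.2 b b.2]
  have hmt : ∀ (i j : A) φ, Set.MapsTo (ρ i) ((ρ j).maxGenEigenspace φ) ((ρ j).maxGenEigenspace φ) :=
    fun i j φ => Module.End.mapsTo_maxGenEigenspace_of_comm (hcomm j i) φ
  have hind : iSupIndep W := by
    have := Module.End.independent_iInf_maxGenEigenspace_of_forall_mapsTo (fun a : A => ρ a) hmt
    rwa [← funext hWeq] at this
  have htop : ⨆ χ, W χ = ⊤ := by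
    have := Module.End.iSup_iInf_maxGenEigenspace_eq_top_of_forall_mapsTo (fun a : A => ρ a) hmt
      (fun i => Module.End.iSup_maxGenEigenspace_eq_top _)
    rw [← this]
    exact iSup_congr hWeq
  have hWmem : ∀ χ v, v ∈ W χ ↔ ∀ a : A, ρ a v = χ a • v := by
    intro χ v
    simp [W, Submodule.mem_iInf, Module.End.mem_eigenspace_iff]
  let X := {χ : A → K // W χ ≠ ⊥}
  have hfin : Finite X := WellFoundedGT.finite_ne_bot_of_iSupIndep hind
  have : Fintype X := Fintype.ofFinite X
  have hcard : Fintype.card X ≤ Module.finrank K V := by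
    have := hind.subtype_ne_bot_le_finrank
    convert this
  have hex : ∀ χ : X, ∃ v, v ≠ 0 ∧ ∀ a : A, ρ a v = χ.1 a • v := by
    intro χ
    obtain ⟨v, hv, hv0⟩ := Submodule.exists_mem_ne_zero_of_ne_bot χ.2
    exact ⟨v, hv0, (hWmem _ _).mp hv⟩
  -- separation
  have hsep : ∀ b : A, (∀ χ : X, χ.1 b = 1) → b = 1 := by
    intro b hb
    have h1 : ∀ χ, W χ ≤ (ρ b).eigenspace 1 := by
      intro χ
      by_cases h : W χ = ⊥
      · rw [h]; exact bot_le
      · rw [← hb ⟨χ, h⟩]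
        exact iInf_le _ b
    have h2 : (⊤ : Submodule K V) ≤ (ρ b).eigenspace 1 := by
      rw [← htop]; exact iSup_le h1
    have h3 : ρ b = ρ 1 := by
      rw [map_one]
      ext v
      have := Module.End.mem_eigenspace_iff.mp (h2 (Submodule.mem_top (x := v)))
      simpa using this
    exact Subtype.ext (hρ h3)
  -- characters
  have hmul : ∀ χ : X, χ.1 1 = 1 ∧ ∀ a b, χ.1 (a * b) = χ.1 a * χ.1 b := by
    intro χ
    obtain ⟨v, hv0, hv⟩ := hex χ
    constructor
    · have := hv 1
      simp only [OneMemClass.coe_one, map_one, Module.End.one_apply] at this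
      have h2 : (χ.1 1 - 1) • v = 0 := by rw [sub_smul, one_smul, ← this, sub_self]
      exact sub_eq_zero.mp ((smul_eq_zero.mp h2).resolve_right hv0)
    · intro a b
      have h1 := hv (a * b)
      rw [Subgroup.coe_mul, map_mul, Module.End.mul_apply, hv b, map_smul, hv a, smul_smul] at h1
      have h2 : (χ.1 (a*b) - χ.1 a * χ.1 b) • v = 0 := by
        rw [sub_smul, ← h1, mul_comm, sub_self]
      exact sub_eq_zero.mp ((smul_eq_zero.mp h2).resolve_right hv0)
  let chi : X → (A →* Kˣ) := fun χ =>
    MonoidHom.toHomUnits { toFun := χ.1, map_one' := (hmul χ).1, map_mul' := (hmul χ).2 }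
  have hchi : ∀ χ a, ((chi χ a : Kˣ) : K) = χ.1 a := fun χ a => rfl
  -- action
  let act : G → (A → K) → (A → K) := fun q χ a => χ (MulAut.conjNormal q⁻¹ a)
  have hact : ∀ q χ, W χ ≠ ⊥ → W (act q χ) ≠ ⊥ := by
    intro q χ h
    obtain ⟨v, hv0, hv⟩ := hex ⟨χ, h⟩
    apply Submodule.ne_bot_iff _ |>.mpr
    refine ⟨ρ q v, (hWmem _ _).mpr ?_, ?_⟩
    · intro a
      have h1 := hv (MulAut.conjNormal q⁻¹ a)
      rw [MulAut.conjNormal_apply] at h1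
      have h2 : (a : G) * q = q * (q⁻¹ * a * q⁻¹⁻¹) := by group
      rw [← Module.End.mul_apply, ← map_mul, h2, map_mul, Module.End.mul_apply, h1, map_smul]
    · intro h0
      apply hv0
      have : ρ (q⁻¹ * q) v = 0 := by rw [map_mul, Module.End.mul_apply, h0, map_zero]
      simpa using this
  let _ : MulAction G X :=
    { smul := fun q χ => ⟨act q χ.1, hact q χ.1 χ.2⟩
      one_smul := by
        intro χ
        apply Subtype.ext
        funext a
        show χ.1 (MulAut.conjNormal (1:G)⁻¹ a) = χ.1 a
        simp
      mul_smul := by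
        intro p q χ
        apply Subtype.ext
        funext a
        show χ.1 (MulAut.conjNormal (p*q)⁻¹ a) = χ.1 (MulAut.conjNormal q⁻¹ (MulAut.conjNormal p⁻¹ a))
        rw [mul_inv_rev, map_mul]; rfl }
  let F : G →* Equiv.Perm X := MulAction.toPermHom G X
  have hker : F.ker ≤ A := by
    intro q hq
    have hq' : ∀ χ : X, q • χ = χ := fun χ => by
      have : F q χ = χ := by rw [MonoidHom.mem_ker.mp hq]; rfl
      exact this
    have hq'' := (F.ker.inv_mem hq)
    have hqi : ∀ χ : X, q⁻¹ • χ = χ := fun χ => by rw [inv_smul_eq_iff, hq']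
    apply hAA
    intro a ha
    have h1 : MulAut.conjNormal q ⟨a, ha⟩ * (⟨a, ha⟩ : A)⁻¹ = 1 := by
      apply hsep
      intro χ
      have h2 : χ.1 (MulAut.conjNormal q ⟨a, ha⟩) = χ.1 ⟨a, ha⟩ := by
        have := congrFun (congrArg Subtype.val (hqi χ)) ⟨a, ha⟩
        have h3 : χ.1 (MulAut.conjNormal q⁻¹⁻¹ ⟨a, ha⟩) = χ.1 ⟨a, ha⟩ := this
        rwa [inv_inv] at h3
      rw [(hmul χ).2, h2, ← (hmul χ).2, mul_inv_cancel, (hmul χ).1]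
    rw [mul_inv_eq_one] at h1
    have := congrArg Subtype.val h1
    rw [MulAut.conjNormal_apply] at this
    exact mul_inv_eq_iff_eq_mul.mp this
  refine GenBy.of_ext F ?_ ?_
  · refine (GenBy.of_finite _).mono ?_
    rw [Nat.card_eq_fintype_card, Fintype.card_perm]
    exact Nat.factorial_le hcard
  · have h1 : GenBy (F.ker.subgroupOf A) (1 * (Finset.univ : Finset X).card) := by
      refine GenBy.of_family chi 1 Finset.univ _ ?_ ?_
      · intro χ _ Q' _
        have : Finite (Q'.map (chi χ)) := ((Set.toFinite (Q' : Set A)).image (chi χ)).to_subtype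
        obtain ⟨g, hg⟩ := (inferInstance : IsCyclic (Q'.map (chi χ))).exists_generator
        apply GenBy.of_top
        refine ⟨{g}, by simp, ?_⟩
        rw [Finset.coe_singleton, ← Subgroup.zpowers_eq_closure, Subgroup.eq_top_iff']
        exact hg
      · intro x _ hx
        apply hsep
        intro χ
        have := hx χ (mem_univ _)
        rw [← hchi, this]; rfl
    have h2 := h1.map A.subtype
    rw [Subgroup.subgroupOf_map_subtype, inf_eq_left.mpr hker] at h2
    rw [top_inf_eq]
    refine h2.mono ?_
    rw [one_mul, Finset.card_univ]
    exact hcard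

end
end CG


namespace CG
open Finset

lemma one_add_pow_expand {M : Type*} [Ring M] (x : M) (n : ℕ) :
    ∃ W, (1 + x)^n = 1 + n * x + x^2 * W := by
  induction n with
  | zero => exact ⟨0, by simp⟩
  | succ n ih =>
    obtain ⟨W, hW⟩ := ih
    refine ⟨n + W * (1 + x), ?_⟩
    rw [pow_succ, hW]
    push_cast
    have : x^2 * (n : M) = n * x^2 := (Nat.cast_commute n (x^2)).symm.eq
    rw [mul_add (x^2), this]
    noncomm_ring

lemma castHom_eq_zero {M N : ℕ} [NeZero N] (h : M ∣ N) (x : ZMod N) (hx : ZMod.castHom h (ZMod M) x = 0) :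
    ∃ y, x = (M : ZMod N) * y := by
  have h1 : x = (x.val : ZMod N) := (ZMod.natCast_zmod_val x).symm
  rw [h1, map_natCast, ZMod.natCast_eq_zero_iff] at hx
  obtain ⟨c, hc⟩ := hx
  exact ⟨c, by rw [h1, hc]; push_cast; rfl⟩

lemma mapMatrix_eq_zero {d M N : ℕ} [NeZero N] (h : M ∣ N) (Y : Matrix (Fin d) (Fin d) (ZMod N))
    (hY : (ZMod.castHom h (ZMod M)).mapMatrix Y = 0) :
    ∃ U, Y = (M : Matrix (Fin d) (Fin d) (ZMod N)) * U := by
  have : ∀ i j, ∃ y, Y i j = (M : ZMod N) * y := by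
    intro i j
    apply castHom_eq_zero h
    have := congrFun (congrFun hY i) j
    simpa using this
  choose U hU using this
  refine ⟨Matrix.of U, ?_⟩
  ext i j
  rw [← nsmul_eq_mul, Matrix.smul_apply, nsmul_eq_mul, Matrix.of_apply]
  exact hU i j

section
variable {d p k : ℕ} [NeZero (p^k)] (hk : p ∣ p^k)

local notation "M" => Matrix (Fin d) (Fin d) (ZMod (p^k))
local notation "SLk" => Matrix.SpecialLinearGroup (Fin d) (ZMod (p^k))

lemma pp_zero {j : ℕ} (h : k ≤ j) : (p : Matrix (Fin d) (Fin d) (ZMod (p^k)))^j = 0 := by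
  have h1 : ((p^k : ℕ) : Matrix (Fin d) (Fin d) (ZMod (p^k))) = 0 := by
    rw [← nsmul_one, ← Nat.cast_smul_eq_nsmul (ZMod (p^k)), ZMod.natCast_self, zero_smul]
  rw [← Nat.sub_add_cancel h, pow_add]
  push_cast at h1
  rw [h1, mul_zero]

/-- level `i` part of a subgroup, as an additive subgroup of matrices over `F_p`. -/
noncomputable def V (hk : p ∣ p^k) (H : Subgroup SLk) (i : ℕ) (hi : 1 ≤ i) : AddSubgroup (Matrix (Fin d) (Fin d) (ZMod p)) where
  carrier := {X | ∃ h ∈ H, ∃ Y : M, (h : M) = 1 + (p : M)^i * Y ∧ (ZMod.castHom hk (ZMod p)).mapMatrix Y = X}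
  zero_mem' := ⟨1, H.one_mem, 0, by simp, by simp⟩
  add_mem' := by
    rintro _ _ ⟨h, hh, Y, hY, rfl⟩ ⟨h', hh', Y', hY', rfl⟩
    refine ⟨h * h', H.mul_mem hh hh', Y + Y' + (p : M)^i * (Y * Y'), ?_, ?_⟩
    · rw [Matrix.SpecialLinearGroup.coe_mul, hY, hY']
      have : Y * (p : M)^i = (p : M)^i * Y := ((Nat.cast_commute p Y).pow_left i).symm.eq
      have h2 : (p : M)^i * Y * ((p : M)^i * Y') = (p : M)^i * ((p : M)^i * (Y * Y')) := by
        rw [mul_assoc, ← mul_assoc Y, this]; simp only [mul_assoc]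
      rw [mul_add, mul_add, mul_one, mul_add, add_mul, one_mul, h2]
      abel
    · rw [map_add, map_add, map_mul, map_pow, map_natCast]
      have : (p : Matrix (Fin d) (Fin d) (ZMod p)) = 0 := by
        rw [← nsmul_one, ← Nat.cast_smul_eq_nsmul (ZMod p), ZMod.natCast_self, zero_smul]
      rw [this, zero_pow (by omega), zero_mul, add_zero]
  neg_mem' := by
    rintro _ ⟨h, hh, Y, hY, rfl⟩
    refine ⟨h⁻¹, H.inv_mem hh, -((h⁻¹ : SLk) : M) * Y, ?_, ?_⟩
    · have h1 : ((h⁻¹ : SLk) : M) * (h : M) = 1 := by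
        rw [← Matrix.SpecialLinearGroup.coe_mul, inv_mul_cancel]; rfl
      have h3 := h1
      rw [hY, mul_add, mul_one] at h3
      have : ((h⁻¹ : SLk) : M) * (p : M)^i = (p : M)^i * ((h⁻¹ : SLk) : M) := ((Nat.cast_commute p ((h⁻¹ : SLk) : M)).pow_left i).symm.eq
      rw [neg_mul, mul_neg, ← mul_assoc, ← this, mul_assoc, ← sub_eq_add_neg]
      exact eq_sub_of_add_eq h3
    · have hp0 : (p : Matrix (Fin d) (Fin d) (ZMod p)) = 0 := by
        rw [← nsmul_one, ← Nat.cast_smul_eq_nsmul (ZMod p), ZMod.natCast_self, zero_smul]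
      have h1 : ((h⁻¹ : SLk) : M) * (h : M) = 1 := by
        rw [← Matrix.SpecialLinearGroup.coe_mul, inv_mul_cancel]; rfl
      have h2 := congrArg (ZMod.castHom hk (ZMod p)).mapMatrix h1
      rw [map_mul, hY, map_add, map_mul, map_pow, map_natCast, hp0, zero_pow (by omega), zero_mul,
        add_zero, map_one, mul_one] at h2
      rw [map_mul, map_neg, h2, neg_one_mul]

lemma V_mono {H H' : Subgroup SLk} (h : H ≤ H') (i : ℕ) (hi : 1 ≤ i) : V hk H i hi ≤ V hk H' i hi := by
  rintro X ⟨g, hg, Y, h1, h2⟩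
  exact ⟨g, h hg, Y, h1, h2⟩

lemma pow_level (g : SLk) (Y : M) {i : ℕ} (hg : (g : M) = 1 + (p : M)^i * Y) :
    ∃ W : M, ((g^p : SLk) : M) = 1 + (p : M)^(i+1) * Y + (p : M)^(2*i) * W := by
  obtain ⟨W, hW⟩ := one_add_pow_expand ((p : M)^i * Y) p
  refine ⟨Y * Y * W, ?_⟩
  have : Y * (p : M)^i = (p : M)^i * Y := ((Nat.cast_commute p Y).pow_left i).symm.eq
  have h2 : (p : M)^i * Y * ((p : M)^i * Y) = (p : M)^i * ((p : M)^i * (Y * Y)) := by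
    rw [mul_assoc, ← mul_assoc Y, this]; simp only [mul_assoc]
  rw [Matrix.SpecialLinearGroup.coe_pow, hg, hW, pow_two, h2, two_mul, pow_add (p : M) i i, pow_succ' (p : M) i]
  simp only [mul_assoc]

lemma V_succ (H : Subgroup SLk) (i : ℕ) (hi : 2 ≤ i) :
    V hk H i (by omega) ≤ V hk H (i+1) (by omega) := by
  rintro X ⟨g, hg, Y, h1, h2⟩
  obtain ⟨W, hW⟩ := pow_level g Y h1
  refine ⟨g^p, H.pow_mem hg p, Y + (p : M)^(i-1) * W, ?_, ?_⟩
  · rw [hW, mul_add, ← mul_assoc, ← pow_add, show i + 1 + (i - 1) = 2 * i by omega, add_assoc]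
  · have hp0 : (p : Matrix (Fin d) (Fin d) (ZMod p)) = 0 := by
      rw [← nsmul_one, ← Nat.cast_smul_eq_nsmul (ZMod p), ZMod.natCast_self, zero_smul]
    rw [map_add, map_mul, map_pow, map_natCast, hp0, zero_pow (by omega), zero_mul, add_zero, h2]

lemma p_rank (hk : p ∣ p^k) (hp : p.Prime) (H : Subgroup SLk) (hH : ∀ g ∈ H, ∃ Y : M, (g : M) = 1 + (p : M)^2 * Y) :
    GenBy H (d * d) := by
  classical
  have := Fact.mk hp
  let D : Subgroup SLk → (i : ℕ) → (hi : 1 ≤ i) → ℕ := fun S i hi =>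
    Module.finrank (ZMod p) (AddSubgroup.toZModSubmodule p (V hk S i hi))
  have hDle : ∀ S i hi, D S i hi ≤ d * d := by
    intro S i hi
    have := Submodule.finrank_le (AddSubgroup.toZModSubmodule p (V hk S i hi))
    rw [Module.finrank_matrix] at this
    simpa using this
  have hDmono : ∀ S S' i i' hi hi', V hk S i hi ≤ V hk S' i' hi' → D S i hi ≤ D S' i' hi' := by
    intro S S' i i' hi hi' h
    exact Submodule.finrank_mono h
  have hDlt : ∀ S S' i i' hi hi', V hk S i hi < V hk S' i' hi' → D S i hi < D S' i' hi' := by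
    intro S S' i i' hi hi' h
    exact Submodule.finrank_lt_finrank_of_lt h
  have main : ∀ i, ∃ s : Finset SLk, (∀ x ∈ s, x ∈ H) ∧
      s.card ≤ D (Subgroup.closure (s : Set SLk)) (i+2) (by omega) ∧
      ∀ x ∈ H, ∃ y ∈ Subgroup.closure (s : Set SLk), ∃ Y : M,
        ((y⁻¹ * x : SLk) : M) = 1 + (p : M)^(i+2) * Y := by
    intro i
    induction i with
    | zero =>
      refine ⟨∅, by simp, by simp, fun x hx => ⟨1, one_mem _, ?_⟩⟩
      simpa using hH x hx
    | succ i ih =>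
      obtain ⟨s, hs1, hs2, hs3⟩ := ih
      -- maximal extension
      let T : Finset (Finset SLk) := Finset.univ.filter fun t => s ⊆ t ∧ (∀ x ∈ t, x ∈ H) ∧
        t.card ≤ D (Subgroup.closure (t : Set SLk)) (i+2) (by omega)
      have hsT : s ∈ T := by
        simp only [T, mem_filter, mem_univ, true_and]
        exact ⟨subset_rfl, hs1, hs2⟩
      obtain ⟨t, htT, htmax⟩ := Finset.exists_max_image T Finset.card ⟨s, hsT⟩
      simp only [T, mem_filter, mem_univ, true_and] at htT htmax
      obtain ⟨hst, htH, htc⟩ := htT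
      have hcl : ∀ u : Finset SLk, (∀ x ∈ u, x ∈ H) → Subgroup.closure (u : Set SLk) ≤ H := by
        intro u hu
        rw [Subgroup.closure_le]; exact hu
      have hV : V hk H (i+2) (by omega) ≤ V hk (Subgroup.closure (t : Set SLk)) (i+2) (by omega) := by
        intro X hX
        by_contra hXn
        obtain ⟨h, hh, Y, hY, hYX⟩ := hX
        have hht : h ∉ t := fun hc => hXn ⟨h, Subgroup.subset_closure hc, Y, hY, hYX⟩
        have hmon : Subgroup.closure (t : Set SLk) ≤ Subgroup.closure ((insert h t : Finset SLk) : Set SLk) :=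
          Subgroup.closure_mono (by simp)
        have hlt := hDlt (Subgroup.closure (t : Set SLk)) (Subgroup.closure ((insert h t : Finset SLk) : Set SLk))
          (i+2) (i+2) (by omega) (by omega)
          (lt_of_le_of_ne (V_mono hk hmon _ _) (by
            intro he
            apply hXn
            rw [he]
            exact ⟨h, Subgroup.subset_closure (by simp), Y, hY, hYX⟩))
        have := htmax (insert h t) ⟨hst.trans (subset_insert _ _), by
          intro x hx
          rcases mem_insert.mp hx with rfl | hx
          · exact hh
          · exact htH x hx, by
          rw [card_insert_of_notMem hht]
          omega⟩
        rw [card_insert_of_notMem hht] at this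
        omega
      refine ⟨t, htH, htc.trans (hDmono _ _ _ _ _ _ (V_succ hk _ _ (by omega))), ?_⟩
      intro x hx
      obtain ⟨y, hy, Y, hY⟩ := hs3 x hx
      have hy' : y ∈ Subgroup.closure (t : Set SLk) := Subgroup.closure_mono (by simpa using hst) hy
      have hwH : y⁻¹ * x ∈ H := H.mul_mem (H.inv_mem (hcl t htH hy')) hx
      obtain ⟨z, hz, Z, hZ, hZX⟩ := hV ⟨y⁻¹ * x, hwH, Y, hY, rfl⟩
      obtain ⟨U, hU⟩ := mapMatrix_eq_zero hk (Y - Z) (by rw [map_sub, hZX, sub_self])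
      refine ⟨y * z, mul_mem hy' hz, ((z⁻¹ : SLk) : M) * U, ?_⟩
      have e1 : (y * z)⁻¹ * x = z⁻¹ * (y⁻¹ * x) := by group
      have e2 : ((y⁻¹ * x : SLk) : M) = (z : M) + (p : M)^(i+1+2) * U := by
        rw [hY, hZ, show i + 1 + 2 = (i + 2) + 1 by omega, pow_succ (p : M) (i+2), mul_assoc, ← hU,
          mul_sub]
        abel
      have h1 : ((z⁻¹ : SLk) : M) * (z : M) = 1 := by
        rw [← Matrix.SpecialLinearGroup.coe_mul, inv_mul_cancel]; rfl
      have : ((z⁻¹ : SLk) : M) * (p : M)^(i+1+2) = (p : M)^(i+1+2) * ((z⁻¹ : SLk) : M) :=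
        ((Nat.cast_commute p ((z⁻¹ : SLk) : M)).pow_left _).symm.eq
      rw [e1, Matrix.SpecialLinearGroup.coe_mul, e2, mul_add, h1, ← mul_assoc, this, mul_assoc]
  obtain ⟨s, hs1, hs2, hs3⟩ := main k
  refine ⟨s, hs2.trans (hDle _ _ _), le_antisymm ((Subgroup.closure_le _).mpr hs1) ?_⟩
  intro x hx
  obtain ⟨y, hy, Y, hY⟩ := hs3 x hx
  rw [pp_zero (by omega), zero_mul, add_zero] at hY
  have : y⁻¹ * x = 1 := Matrix.SpecialLinearGroup.ext _ _ (fun i j => by rw [hY]; rfl)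
  rw [← inv_mul_eq_one.mp this]
  exact hy

lemma ker_pgroup (g : SLk) (Y : M) (hg : (g : M) = 1 + (p : M) * Y) : ∃ j, g ^ (p^j) = 1 := by
  have : ∀ j, ∃ Y : M, ((g^(p^j) : SLk) : M) = 1 + (p : M)^(j+1) * Y := by
    intro j
    induction j with
    | zero => exact ⟨Y, by simpa using hg⟩
    | succ j ih =>
      obtain ⟨Z, hZ⟩ := ih
      obtain ⟨W, hW⟩ := pow_level _ Z hZ
      refine ⟨Z + (p : M)^j * W, ?_⟩
      rw [pow_succ p, pow_mul, hW, mul_add ((p : M)^(j+1+1)), ← mul_assoc, ← pow_add,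
        show j + 1 + 1 + j = 2 * (j + 1) by omega, add_assoc]
  obtain ⟨Z, hZ⟩ := this k
  refine ⟨k, Matrix.SpecialLinearGroup.ext _ _ fun i j => ?_⟩
  rw [hZ, pp_zero (by omega), zero_mul, add_zero]; rfl

end
end CG


namespace CG
open Finset

lemma sl_card (d m : ℕ) [NeZero m] :
    Nat.card (Matrix.SpecialLinearGroup (Fin d) (ZMod m)) ≤ m^(d*d) := by
  have h := Nat.card_le_card_of_injective
    (fun g : Matrix.SpecialLinearGroup (Fin d) (ZMod m) => (g : Matrix (Fin d) (Fin d) (ZMod m)))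
    (fun a b h => Subtype.ext h)
  refine h.trans (le_of_eq ?_)
  have : Nat.card (Matrix (Fin d) (Fin d) (ZMod m)) = Nat.card (Fin d → Fin d → ZMod m) := rfl
  rw [this, Nat.card_fun, Nat.card_fun, Nat.card_zmod, ← pow_mul]
  simp

def Crk (d : ℕ) : ℕ := 3 * (d * d) + d.factorial + d

theorem rank_pk {d p k l : ℕ} (hp : p.Prime) (hk : 2 ≤ k) (hl : l.Prime)
    (Q : Subgroup (Matrix.SpecialLinearGroup (Fin d) (ZMod (p^k)))) (hQ : IsPGroup l Q) :
    GenBy Q (Crk d) := by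
  classical
  have hpf := Fact.mk hp
  have hne : NeZero (p^k) := ⟨(pow_pos hp.pos k).ne'⟩
  have hpk : p ∣ p^k := dvd_pow_self p (by omega)
  by_cases hlp : l = p
  · subst hlp
    have hdvd : l^2 ∣ l^k := pow_dvd_pow l hk
    have hne2 : NeZero (l^2) := ⟨(pow_pos hp.pos 2).ne'⟩
    let F : Matrix.SpecialLinearGroup (Fin d) (ZMod (l^k)) →* Matrix.SpecialLinearGroup (Fin d) (ZMod (l^2)) :=
      Matrix.SpecialLinearGroup.map (ZMod.castHom hdvd (ZMod (l^2)))
    have h1 : GenBy (Q.map F) (2 * (d * d)) := by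
      have hQ' : IsPGroup l (Q.map F) := hQ.map F
      obtain ⟨n, hn⟩ := IsPGroup.iff_card.mp hQ'
      apply GenBy.of_card hp
      rw [hn]
      apply pow_dvd_pow
      have h2 : l^n ≤ l^(2*(d*d)) := by
        rw [← hn, pow_mul]
        exact (Subgroup.card_le_card_group _).trans (sl_card d (l^2))
      exact (Nat.pow_le_pow_iff_right hp.one_lt).mp h2
    have h2 : GenBy (Q ⊓ F.ker) (d * d) := by
      apply p_rank hpk hp
      intro g hg
      have hgk : F g = 1 := MonoidHom.mem_ker.mp hg.2
      obtain ⟨U, hU⟩ := mapMatrix_eq_zero hdvd ((g : Matrix (Fin d) (Fin d) (ZMod (l^k))) - 1) (by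
        have := congrArg (Subtype.val) hgk
        have h3 : (ZMod.castHom hdvd (ZMod (l^2))).mapMatrix (g : Matrix (Fin d) (Fin d) (ZMod (l^k))) = 1 := this
        rw [map_sub, h3, map_one, sub_self])
      refine ⟨U, ?_⟩
      push_cast at hU
      rw [← hU]; abel
    refine (GenBy.of_ext F h1 h2).mono ?_
    unfold Crk; omega
  · let K := AlgebraicClosure (ZMod p)
    have : CharP K p := charP_of_injective_algebraMap (algebraMap (ZMod p) K).injective p
    have hlK : (l : K) ≠ 0 := by
      intro h
      rw [CharP.cast_eq_zero_iff K p] at h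
      exact hlp ((Nat.prime_dvd_prime_iff_eq hp hl).mp h).symm
    let f : ZMod (p^k) →+* K := (algebraMap (ZMod p) K).comp (ZMod.castHom hpk (ZMod p))
    let c : Q →* Matrix (Fin d) (Fin d) (ZMod (p^k)) :=
      { toFun := fun g => (g.1 : Matrix (Fin d) (Fin d) (ZMod (p^k)))
        map_one' := rfl
        map_mul' := fun a b => rfl }
    let t : Matrix (Fin d) (Fin d) K ≃ₐ[K] Module.End K (Fin d → K) := Matrix.toLinAlgEquiv'
    let ρ : Q →* Module.End K (Fin d → K) :=
      ((t : Matrix (Fin d) (Fin d) K →* Module.End K (Fin d → K)).comp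
        (f.mapMatrix : Matrix (Fin d) (Fin d) (ZMod (p^k)) →+* Matrix (Fin d) (Fin d) K).toMonoidHom).comp c
    have hρ : Function.Injective ρ := by
      rw [injective_iff_map_eq_one]
      intro g hg
      have h1 : t (f.mapMatrix (c g)) = t 1 := by rw [map_one]; exact hg
      have h2 : f.mapMatrix (c g) = 1 := t.injective h1
      have h3 : (ZMod.castHom hpk (ZMod p)).mapMatrix (c g - 1) = 0 := by
        have h4 : (algebraMap (ZMod p) K).mapMatrix ((ZMod.castHom hpk (ZMod p)).mapMatrix (c g - 1)) = 0 := by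
          have h5 : (algebraMap (ZMod p) K).mapMatrix ((ZMod.castHom hpk (ZMod p)).mapMatrix (c g - 1))
            = f.mapMatrix (c g - 1) := rfl
          rw [h5, map_sub, h2, map_one, sub_self]
        ext i j
        have := congrFun (congrFun h4 i) j
        simp only [RingHom.mapMatrix_apply, Matrix.map_apply, Matrix.zero_apply] at this ⊢
        exact (map_eq_zero (algebraMap (ZMod p) K)).mp this
      obtain ⟨U, hU⟩ := mapMatrix_eq_zero hpk _ h3
      obtain ⟨j, hj⟩ := ker_pgroup (p := p) (k := k) g.1 U (by rw [← hU]; show c g = _; abel)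
      obtain ⟨i, hi⟩ := hQ g
      have hj' : g ^ p^j = 1 := Subtype.ext hj
      have hco : Nat.Coprime (l^i) (p^j) := Nat.Coprime.pow _ _ ((Nat.coprime_primes hl hp).mpr hlp)
      have := Nat.dvd_gcd (orderOf_dvd_of_pow_eq_one hi) (orderOf_dvd_of_pow_eq_one hj')
      rw [hco.gcd_eq_one, Nat.dvd_one] at this
      exact orderOf_eq_one_iff.mp this
    have := ell_rank hl hlK hQ ρ hρ
    rw [Module.finrank_fin_fun] at this
    refine (GenBy.of_top this).mono ?_
    unfold Crk; omega

theorem rank_m {d m l : ℕ} (hm : 1 ≤ m) (hsq : ∀ p ∈ m.primeFactors, 2 ≤ m.factorization p) (hl : l.Prime)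
    (Q : Subgroup (Matrix.SpecialLinearGroup (Fin d) (ZMod m))) (hQ : IsPGroup l Q) :
    GenBy Q (Crk d * m.primeFactors.card) := by
  classical
  have : NeZero m := ⟨by omega⟩
  let f : ∀ p : ℕ, Matrix.SpecialLinearGroup (Fin d) (ZMod m) →*
      Matrix.SpecialLinearGroup (Fin d) (ZMod (p^(m.factorization p))) := fun p =>
    Matrix.SpecialLinearGroup.map (ZMod.castHom (Nat.ordProj_dvd m p) (ZMod (p^(m.factorization p))))
  refine GenBy.of_family f (Crk d) m.primeFactors Q ?_ ?_
  · intro p hp Q' hQ'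
    exact rank_pk (Nat.prime_of_mem_primeFactors hp) (hsq p hp) hl _ ((hQ.to_le hQ').map _)
  · intro x hx h
    apply Matrix.SpecialLinearGroup.ext
    intro i j
    have h1 : ∀ p ∈ m.primeFactors, p^(m.factorization p) ∣
        (x i j - (1 : Matrix (Fin d) (Fin d) (ZMod m)) i j).val := by
      intro p hp
      have h2 := congrFun (congrFun (congrArg Subtype.val (h p hp)) i) j
      have h3 : ZMod.castHom (Nat.ordProj_dvd m p) (ZMod (p^(m.factorization p))) (x i j) =
        (1 : Matrix (Fin d) (Fin d) (ZMod (p^(m.factorization p)))) i j := h2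
      rw [← ZMod.natCast_eq_zero_iff, ← map_natCast (ZMod.castHom (Nat.ordProj_dvd m p) (ZMod (p^(m.factorization p)))),
        ZMod.natCast_zmod_val, map_sub, h3, Matrix.one_apply, Matrix.one_apply]
      split_ifs
      · rw [map_one, sub_self]
      · rw [map_zero, sub_self]
    have h2 : m ∣ (x i j - (1 : Matrix (Fin d) (Fin d) (ZMod m)) i j).val := by
      conv_lhs => rw [← Nat.prod_factorization_pow_eq_self (show m ≠ 0 by omega)]
      apply Finset.prod_dvd_of_isRelPrime
      · intro p hp q hq hpq
        exact Nat.coprime_iff_isRelPrime.mp (Nat.Coprime.pow _ _ ((Nat.coprime_primes (Nat.prime_of_mem_primeFactors hp)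
          (Nat.prime_of_mem_primeFactors hq)).mpr hpq))
      · intro p hp
        exact h1 p hp
    have h3 := Nat.eq_zero_of_dvd_of_lt h2 (ZMod.val_lt _)
    rw [ZMod.val_eq_zero, sub_eq_zero] at h3
    exact h3

end CG


namespace CG
open Finset

lemma factorial_card_le_prod (s : Finset ℕ) : (∀ x ∈ s, 1 ≤ x) → s.card.factorial ≤ ∏ x ∈ s, x ∧ ∀ y, (∀ x ∈ s, x < y) → s.card + 1 ≤ max y 1 := by
  induction s using Finset.induction_on_max with
  | empty => intro _; simp
  | insert a s hlt ih =>
    intro h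
    obtain ⟨h1, h2⟩ := ih (fun x hx => h x (mem_insert_of_mem hx))
    have ha : a ∉ s := fun hc => (hlt a hc).false
    have ha1 := h a (mem_insert_self _ _)
    have h3 := h2 a hlt
    rw [max_eq_left ha1] at h3
    rw [card_insert_of_notMem ha, prod_insert ha, Nat.factorial_succ]
    refine ⟨Nat.mul_le_mul h3 h1, fun y hy => ?_⟩
    have := hy a (mem_insert_self _ _)
    omega

lemma omega_factorial_le {k : ℕ} (hk : 1 ≤ k) : k.primeFactors.card.factorial ≤ k := by
  refine (factorial_card_le_prod k.primeFactors (fun x hx => (Nat.prime_of_mem_primeFactors hx).one_lt.le)).1.trans ?_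
  exact Nat.le_of_dvd (by omega) (Nat.prod_primeFactors_dvd k)

lemma ker_sq_le (d m : ℕ) : (redSL d (m^2)).ker ≤ (redSL d m).ker := by
  intro g hg
  rw [MonoidHom.mem_ker] at hg ⊢
  have hd : m ∣ m^2 := dvd_pow_self m (by norm_num)
  have h : redSL d m g = Matrix.SpecialLinearGroup.map (ZMod.castHom hd (ZMod m)) (redSL d (m^2) g) := by
    ext i j
    simp [redSL]
  rw [h, hg, map_one]

/-- the encoding of congruence subgroups -/
lemma exists_encoding (d n : ℕ) : ∃ F : {H : Subgroup (Matrix.SpecialLinearGroup (Fin d) ℤ) //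
    IsCongruenceSubgroup H ∧ H.index ≤ n} →
    (Σ m : Fin (n^(2*d^2)), Subgroup (Matrix.SpecialLinearGroup (Fin d) (ZMod ((m.1+1)^2)))),
    Function.Injective F := by
  have key : ∀ H : {H : Subgroup (Matrix.SpecialLinearGroup (Fin d) ℤ) //
    IsCongruenceSubgroup H ∧ H.index ≤ n}, ∃ m : Fin (n^(2*d^2)), (redSL d ((m.1+1)^2)).ker ≤ H.1 := by
    rintro ⟨H, ⟨M, hM, hker⟩, hn⟩
    obtain ⟨m, h1, h2, h3⟩ := level_bound hM H hker
    have h4 : m ≤ n^(2*d^2) := h2.trans (Nat.pow_le_pow_left hn _)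
    refine ⟨⟨m-1, by omega⟩, ?_⟩
    rw [show (m - 1 + 1) = m by omega]
    exact (ker_sq_le d m).trans h3
  choose f hf using key
  refine ⟨fun H => ⟨f H, H.1.map (redSL d (((f H).1+1)^2))⟩, ?_⟩
  intro H H' h
  have h1 : ∀ H : {H : Subgroup (Matrix.SpecialLinearGroup (Fin d) ℤ) //
    IsCongruenceSubgroup H ∧ H.index ≤ n}, (H.1.map (redSL d (((f H).1+1)^2))).comap (redSL d (((f H).1+1)^2)) = H.1 := by
    intro H
    rw [Subgroup.comap_map_eq, sup_eq_left.mpr (hf H)]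
  have h2 : ∀ s t : (Σ m : Fin (n^(2*d^2)), Subgroup (Matrix.SpecialLinearGroup (Fin d) (ZMod ((m.1+1)^2)))),
      s = t → s.2.comap (redSL d ((s.1.1+1)^2)) = t.2.comap (redSL d ((t.1.1+1)^2)) := by
    rintro s t rfl; rfl
  have h3 := h2 _ _ h
  dsimp only at h3
  rw [h1, h1] at h3
  exact Subtype.ext h3

lemma finite_cong (d n : ℕ) : Finite {H : Subgroup (Matrix.SpecialLinearGroup (Fin d) ℤ) //
    IsCongruenceSubgroup H ∧ H.index ≤ n} := by
  obtain ⟨F, hF⟩ := exists_encoding d n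
  have : ∀ m : Fin (n^(2*d^2)), NeZero ((m.1+1)^2) := fun m => ⟨by positivity⟩
  exact Finite.of_injective F hF

theorem upper_count (d n w : ℕ) (hd : 1 ≤ d) (hn : 1 ≤ n)
    (hw : ∀ k, 1 ≤ k → k ≤ n^(4*d^4) → k.primeFactors.card ≤ w) :
    congCount d n ≤ n^(2*d^2 + 4*d^4 * ((1 + Crk d) * w)) := by
  obtain ⟨F, hF⟩ := exists_encoding d n
  have : ∀ m : Fin (n^(2*d^2)), NeZero ((m.1+1)^2) := fun m => ⟨by positivity⟩
  have h1 : ∀ m : Fin (n^(2*d^2)), Nat.card (Subgroup (Matrix.SpecialLinearGroup (Fin d) (ZMod ((m.1+1)^2))))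
      ≤ n^(4*d^4 * ((1 + Crk d) * w)) := by
    intro m
    set M := (m.1+1)^2 with hM
    have hM1 : 1 ≤ M := Nat.one_le_iff_ne_zero.mpr (NeZero.ne _)
    have hcl := card_subgroup_le (G := Matrix.SpecialLinearGroup (Fin d) (ZMod M)) (Crk d * M.primeFactors.card)
      (fun l hl Q hQ => rank_m hM1 (by
        intro p hp
        rw [hM, Nat.primeFactors_pow _ (by norm_num)] at hp
        rw [hM, Nat.factorization_pow]
        have := (Nat.prime_of_mem_primeFactors hp).factorization_pos_of_dvd (by omega) (Nat.dvd_of_mem_primeFactors hp)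
        simp; omega) hl Q hQ)
    have hMX : M^(d*d) ≤ n^(4*d^4) := by
      have : M ≤ n^(2*d^2*2) := by
        exact (Nat.pow_le_pow_left m.2 2).trans (le_of_eq (pow_mul _ _ _).symm)
      calc M^(d*d) ≤ (n^(2*d^2*2))^(d*d) := Nat.pow_le_pow_left this _
        _ = _ := by rw [← pow_mul]; congr 1; ring
    have hN := (sl_card d M).trans hMX
    have hN1 : 1 ≤ Nat.card (Matrix.SpecialLinearGroup (Fin d) (ZMod M)) := Nat.one_le_iff_ne_zero.mpr Nat.card_pos.ne'
    have hMX2 : M ≤ n^(4*d^4) := (Nat.le_self_pow (by positivity) M).trans hMX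
    have e1 := hw _ hN1 hN
    have e2 := hw _ hM1 hMX2
    refine hcl.trans ?_
    rw [pow_mul]
    refine (Nat.pow_le_pow_left hN _).trans (Nat.pow_le_pow_right (by positivity) ?_)
    calc _ ≤ w + Crk d * w := Nat.add_le_add e1 (Nat.mul_le_mul_left _ e2)
      _ = _ := by ring
  have h2 := Nat.card_le_card_of_injective F hF
  rw [Nat.card_sigma] at h2
  unfold congCount
  refine h2.trans ((Finset.sum_le_sum fun m _ => h1 m).trans ?_)
  rw [Finset.sum_const, Finset.card_univ, Fintype.card_fin, smul_eq_mul, pow_add]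

end CG


namespace CG
open Finset

lemma log_le_half {x : ℝ} (hx : 16 ≤ x) : Real.log x ≤ x / 2 - 1 := by
  have h1 : Real.log x = 2 * Real.log (Real.sqrt x) := by
    rw [Real.log_sqrt (by linarith)]; ring
  have h2 : Real.log (Real.sqrt x) ≤ Real.sqrt x - 1 := Real.log_le_sub_one_of_pos (Real.sqrt_pos.mpr (by linarith))
  have h3 : 4 ≤ Real.sqrt x := Real.le_sqrt_of_sq_le (by linarith)
  have h4 : Real.sqrt x * Real.sqrt x = x := Real.mul_self_sqrt (by linarith)
  nlinarith

lemma eventually_loglog (A : ℝ) : ∃ N : ℕ, ∀ n : ℕ, N ≤ n → 1 ≤ n ∧ A ≤ Real.log (Real.log n) := by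
  have h : Filter.Tendsto (fun n : ℕ => Real.log (Real.log (n:ℝ))) Filter.atTop Filter.atTop :=
    Real.tendsto_log_atTop.comp (Real.tendsto_log_atTop.comp tendsto_natCast_atTop_atTop)
  obtain ⟨N, hN⟩ := Filter.eventually_atTop.mp ((h.eventually_ge_atTop A).and (Filter.eventually_ge_atTop 1))
  exact ⟨N, fun n hn => ⟨(hN n hn).2, (hN n hn).1⟩⟩

lemma log_pos_of_loglog {n : ℕ} (h : 16 ≤ Real.log (Real.log n)) : Real.log (Real.log n) ≤ Real.log n ∧ 16 ≤ Real.log n := by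
  have h0 : 0 ≤ Real.log (n:ℝ) := Real.log_natCast_nonneg n
  have h1 : Real.log (Real.log n) ≤ Real.log n := Real.log_le_self h0
  exact ⟨h1, h.trans h1⟩

lemma omega_le {E n k : ℕ} (hn1 : 1 ≤ n) (hn : 16 ≤ Real.log (Real.log n)) (hk : 1 ≤ k) (hkn : k ≤ n^E) :
    (k.primeFactors.card : ℝ) ≤ (2 * E + 1) * Real.log n / Real.log (Real.log n) := by
  obtain ⟨h1, h2⟩ := log_pos_of_loglog hn
  set L := Real.log n with hL
  set l := Real.log L with hl
  set r := k.primeFactors.card with hr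
  by_contra hcon
  push Not at hcon
  have hlpos : 0 < l := by linarith
  have hLpos : 0 < L := by linarith
  have hy : L / l ≤ (2 * E + 1) * L / l := by
    apply div_le_div_of_nonneg_right _ hlpos.le
    have : (0:ℝ) ≤ E := Nat.cast_nonneg _
    nlinarith
  have hLl : 0 < L / l := div_pos hLpos hlpos
  have hrpos : (0:ℝ) < r := by linarith
  have hlogr : l / 2 + 1 ≤ Real.log r := by
    have h3 : Real.log (L / l) ≤ Real.log r := Real.log_le_log hLl (by linarith)
    rw [Real.log_div hLpos.ne' hlpos.ne'] at h3
    have := log_le_half hn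
    linarith
  have hfac : (r : ℝ) * Real.log r - r ≤ E * L := by
    have h3 := Real.pow_div_factorial_le_exp (r : ℝ) hrpos.le r
    have hf : (0:ℝ) < r.factorial := by exact_mod_cast Nat.factorial_pos r
    rw [div_le_iff₀ hf] at h3
    have h4 := Real.log_le_log (pow_pos hrpos r) h3
    rw [Real.log_pow, Real.log_mul (Real.exp_pos _).ne' hf.ne', Real.log_exp] at h4
    have h5 : (r.factorial : ℝ) ≤ (n:ℝ)^E := by
      exact_mod_cast (omega_factorial_le hk).trans hkn
    have h6 := Real.log_le_log hf h5
    rw [Real.log_pow] at h6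
    linarith
  have h7 : r * (l / 2) ≤ E * L := by nlinarith
  have h8 : (2 * E + 1) * L < r * l := by rwa [div_lt_iff₀ hlpos] at hcon
  nlinarith

theorem upper_main (d : ℕ) (hd : 2 ≤ d) : ∃ b : ℝ, 0 < b ∧ ∃ N : ℕ, ∀ n : ℕ, N ≤ n →
    (congCount d n : ℝ) ≤ (n : ℝ) ^ (b * Real.log n / Real.log (Real.log n)) := by
  obtain ⟨N, hN⟩ := eventually_loglog 16
  let C : ℝ := 2 * ((4 * d^4 : ℕ) : ℝ) + 1
  have hC : 0 < C := by positivity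
  refine ⟨2 * d^2 + 4 * d^4 * ((1 + Crk d) * C), by positivity, N, fun n hn => ?_⟩
  obtain ⟨hn1, hn2⟩ := hN n hn
  obtain ⟨h1, h2⟩ := log_pos_of_loglog hn2
  set L := Real.log n with hL
  set l := Real.log L with hl
  have hlpos : 0 < l := by linarith
  have hLpos : 0 < L := by linarith
  let w : ℕ := ⌊C * L / l⌋₊
  have hw0 : 0 ≤ C * L / l := by positivity
  have hwle : (w : ℝ) ≤ C * L / l := Nat.floor_le hw0
  have hub := upper_count d n w (by omega) hn1 (fun k hk hkn => Nat.le_floor (omega_le hn1 hn2 hk hkn))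
  have hub' : (congCount d n : ℝ) ≤ (n:ℝ)^(2*d^2 + 4*d^4 * ((1 + Crk d) * w)) := by exact_mod_cast hub
  refine hub'.trans ?_
  rw [← Real.rpow_natCast]
  apply Real.rpow_le_rpow_of_exponent_le (by exact_mod_cast hn1)
  push_cast
  have hq : 1 ≤ L / l := by rw [le_div_iff₀ hlpos]; linarith
  have e : (2 * (d:ℝ)^2 + 4 * d^4 * ((1 + Crk d) * C)) * L / l = 2 * (d:ℝ)^2 * (L / l) + 4 * d^4 * ((1 + Crk d) * (C * L / l)) := by
    ring
  rw [e]
  apply add_le_add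
  · have : (0:ℝ) ≤ 2 * d^2 := by positivity
    nlinarith
  · gcongr

end CG


namespace CG
open Finset

section
variable {r q : ℕ} {U : Fin r ⊕ Fin r → Type*} [∀ i, CommGroup (U i)]

/-- the graph homomorphism attached to an integer matrix -/
def graphHom (u : ∀ i, U i) (A : Fin r → Fin r → Fin q) :
    Multiplicative (Fin r → ℤ) →* (∀ i, U i) where
  toFun n := fun i => match i with
    | Sum.inl j => u (Sum.inl j) ^ (n.toAdd j)
    | Sum.inr i => u (Sum.inr i) ^ (∑ j, ((A i j : ℕ) : ℤ) * n.toAdd j)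
  map_one' := by
    funext i
    rcases i with i | i <;> simp
  map_mul' x y := by
    funext i
    rcases i with i | i
    · simp [zpow_add]
    · simp [mul_add, Finset.sum_add_distrib, zpow_add]

lemma graphHom_inl (u : ∀ i, U i) (A : Fin r → Fin r → Fin q) (n) (j) :
    graphHom u A n (Sum.inl j) = u (Sum.inl j) ^ (n.toAdd j) := rfl

lemma graphHom_inr (u : ∀ i, U i) (A : Fin r → Fin r → Fin q) (n) (i) :
    graphHom u A n (Sum.inr i) = u (Sum.inr i) ^ (∑ j, ((A i j : ℕ) : ℤ) * n.toAdd j) := rfl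

lemma graph_injective (u : ∀ i, U i) (hu : ∀ i, orderOf (u i) = q) :
    Function.Injective (fun A : Fin r → Fin r → Fin q => (graphHom u A).range) := by
  classical
  intro A B h
  have hz : ∀ i (a b : ℤ), u i ^ a = u i ^ b → (q : ℤ) ∣ b - a := by
    intro i a b hab
    have h1 := (orderOf_dvd_iff_zpow_eq_one (x := u i) (i := b - a)).mpr (by rw [zpow_sub, hab, mul_inv_cancel])
    rwa [hu] at h1
  funext i j
  have h1 : graphHom u B (Multiplicative.ofAdd (Pi.single j 1)) ∈ (graphHom u A).range := by
    show _ ∈ (fun A : Fin r → Fin r → Fin q => (graphHom u A).range) A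
    rw [h]; exact ⟨_, rfl⟩
  obtain ⟨n, hn⟩ := h1
  have h2 : ∀ j', (q : ℤ) ∣ (Pi.single j 1 : Fin r → ℤ) j' - n.toAdd j' := by
    intro j'
    have := congrFun hn (Sum.inl j')
    rw [graphHom_inl, graphHom_inl] at this
    exact hz _ _ _ this
  have h3 := congrFun hn (Sum.inr i)
  rw [graphHom_inr, graphHom_inr] at h3
  have h4 := hz _ _ _ h3
  have h5 : (q : ℤ) ∣ ∑ j', ((A i j' : ℕ) : ℤ) * (Pi.single j 1 : Fin r → ℤ) j' - ∑ j', ((A i j' : ℕ) : ℤ) * n.toAdd j' := by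
    rw [← Finset.sum_sub_distrib]
    apply Finset.dvd_sum
    intro j' _
    rw [← mul_sub]
    exact (h2 j').mul_left _
  have h6 := dvd_sub h4 h5
  simp only [toAdd_ofAdd, Pi.single_apply, mul_ite, mul_one, mul_zero, Finset.sum_ite_eq', mem_univ, if_true] at h6
  have h7 : (q : ℤ) ∣ ((B i j : ℕ) : ℤ) - ((A i j : ℕ) : ℤ) := by
    have e : ((B i j : ℕ) : ℤ) - ((A i j : ℕ) : ℤ) = (((B i j : ℕ) : ℤ) - ∑ x, ((A i x : ℕ) : ℤ) * n.toAdd x) - (((A i j : ℕ) : ℤ) - ∑ x, ((A i x : ℕ) : ℤ) * n.toAdd x) := by ring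
    rw [e]; exact h6
  have hA := (A i j).2
  have hB := (B i j).2
  have h8 : ((B i j : ℕ) : ℤ) - ((A i j : ℕ) : ℤ) = 0 := by
    apply Int.eq_zero_of_abs_lt_dvd h7
    rw [abs_lt]; constructor <;> omega
  apply Fin.ext
  omega

end

/-- the torus embedding -/
def torus {R : Type*} [CommRing R] (d : ℕ) (hd : 2 ≤ d) : Rˣ →* Matrix.SpecialLinearGroup (Fin d) R where
  toFun t := ⟨Matrix.diagonal (fun i => if i = ⟨0, by omega⟩ then (t : R) else if i = ⟨1, by omega⟩ then ((t⁻¹ : Rˣ) : R) else 1), by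
    rw [Matrix.det_diagonal, Finset.prod_ite, Finset.prod_ite]
    simp [Finset.filter_filter]
    have e1 : (Finset.univ.filter fun i : Fin d => i = ⟨0, by omega⟩) = {⟨0, by omega⟩} := by ext; simp
    have e2 : (Finset.univ.filter fun i : Fin d => ¬ i = ⟨0, by omega⟩ ∧ i = ⟨1, by omega⟩) = {⟨1, by omega⟩} := by
      ext i
      simp only [mem_filter, mem_univ, true_and, mem_singleton, and_iff_right_iff_imp]
      rintro rfl; simp
    simp [e1, e2]⟩
  map_one' := by
    apply Matrix.SpecialLinearGroup.ext
    intro i j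
    simp
  map_mul' s t := by
    apply Subtype.ext
    show Matrix.diagonal _ = Matrix.diagonal _ * Matrix.diagonal _
    rw [Matrix.diagonal_mul_diagonal]
    congr 1
    funext i
    split_ifs <;> simp [mul_comm]

lemma torus_injective {R : Type*} [CommRing R] (d : ℕ) (hd : 2 ≤ d) : Function.Injective (torus (R := R) d hd) := by
  intro s t h
  have := congrArg (fun g : Matrix.SpecialLinearGroup (Fin d) R => g.1 ⟨0, by omega⟩ ⟨0, by omega⟩) h
  simp only [torus, MonoidHom.coe_mk, OneHom.coe_mk, Matrix.diagonal_apply_eq, if_true] at this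
  exact Units.ext this

lemma exists_order {p q : ℕ} (hp : p.Prime) (hq : q ∣ p - 1) : ∃ u : (ZMod p)ˣ, orderOf u = q := by
  have := Fact.mk hp
  obtain ⟨g, hg⟩ := IsCyclic.exists_ofOrder_eq_natCard (α := (ZMod p)ˣ)
  have hc : orderOf g = p - 1 := by rw [hg, Nat.card_eq_fintype_card, ZMod.card_units]
  have h1 := hp.two_le
  refine ⟨g ^ (orderOf g / q), ?_⟩
  apply orderOf_pow_orderOf_div
  · rw [hc]; omega
  · rw [hc]; exact hq

theorem lower_count (d n r q : ℕ) (hd : 2 ≤ d) (a : Fin r ⊕ Fin r → ℕ) (ha : Function.Injective a)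
    (hp : ∀ i, (a i).Prime) (hq : ∀ i, q ∣ a i - 1) (hm : (∏ i, a i)^(d*d) ≤ n) :
    q^(r*r) ≤ congCount d n := by
  classical
  set m := ∏ i, a i with hmdef
  have hm0 : NeZero m := ⟨by rw [hmdef]; exact Finset.prod_ne_zero_iff.mpr fun i _ => (hp i).ne_zero⟩
  choose u hu using fun i => exists_order (hp i) (hq i)
  have hco : Pairwise (Function.onFun Nat.Coprime a) := fun i j hij =>
    (Nat.coprime_primes (hp i) (hp j)).mpr (fun h => hij (ha h))
  let e : ZMod m ≃+* (∀ i, ZMod (a i)) := ZMod.prodEquivPi a hco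
  let F : (∀ i, (ZMod (a i))ˣ) →* Matrix.SpecialLinearGroup (Fin d) (ZMod m) :=
    ((torus d hd).comp (Units.mapEquiv e.symm.toMulEquiv).toMonoidHom).comp
      (MulEquiv.piUnits (M := fun i => ZMod (a i))).symm.toMonoidHom
  have hF : Function.Injective F := by
    intro x y hxy
    have h1 := torus_injective (R := ZMod m) d hd hxy
    exact (MulEquiv.piUnits (M := fun i => ZMod (a i))).symm.injective
      ((Units.mapEquiv e.symm.toMulEquiv).injective h1)
  let S : (Fin r → Fin r → Fin q) → Subgroup (Matrix.SpecialLinearGroup (Fin d) ℤ) :=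
    fun A => ((graphHom u A).range.map F).comap (redSL d m)
  have hS : Function.Injective S := by
    intro A B h
    exact graph_injective u hu (Subgroup.map_injective hF (Subgroup.comap_injective (redSL_surjective d m) h))
  have hcong : ∀ A, IsCongruenceSubgroup (S A) ∧ (S A).index ≤ n := by
    intro A
    constructor
    · exact ⟨m, Nat.one_le_iff_ne_zero.mpr hm0.out, (redSL d m).ker_le_comap _⟩
    · have h1 : (S A).index = ((graphHom u A).range.map F).index :=
        Subgroup.index_comap_of_surjective _ (redSL_surjective d m)
      rw [h1]
      exact (Nat.le_of_dvd Nat.card_pos (Subgroup.index_dvd_card _)).trans ((sl_card d m).trans hm)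
  have := finite_cong d n
  have h := Nat.card_le_card_of_injective
    (fun A => (⟨S A, hcong A⟩ : {H : Subgroup (Matrix.SpecialLinearGroup (Fin d) ℤ) //
    IsCongruenceSubgroup H ∧ H.index ≤ n})) (fun A B h => hS (congrArg Subtype.val h))
  unfold congCount
  refine le_trans (le_of_eq ?_) h
  rw [Nat.card_fun, Nat.card_fun]
  simp [pow_mul]

end CG


namespace CG
open Finset

theorem lower_main (d : ℕ) (hd : 2 ≤ d) : ∃ a : ℝ, 0 < a ∧ ∃ N : ℕ, ∀ n : ℕ, N ≤ n →
    (n : ℝ) ^ (a * Real.log n / Real.log (Real.log n)) ≤ (congCount d n : ℝ) := by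
  obtain ⟨A, J0, hA, hJ⟩ := nt_main
  obtain ⟨N, hN⟩ := eventually_loglog (16 * A * d^2 + 2^J0 + 16)
  have hA' : (1:ℝ) ≤ A := by exact_mod_cast hA
  have hd' : (2:ℝ) ≤ d := by exact_mod_cast hd
  refine ⟨1 / (256 * A^2 * d^4), by positivity, N, fun n hn => ?_⟩
  obtain ⟨hn1, hn2⟩ := hN n hn
  have hpos1 : (0:ℝ) ≤ 16 * A * d^2 := by positivity
  have hpos2 : (0:ℝ) < 2^J0 := by positivity
  have hn16 : 16 ≤ Real.log (Real.log n) := by linarith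
  obtain ⟨h1, h2⟩ := log_pos_of_loglog hn16
  set L := Real.log n with hL
  set l := Real.log L with hl
  have hlpos : 0 < l := by linarith
  have hLpos : 0 < L := by linarith
  obtain ⟨J, hJ1, hJ2⟩ := exists_nat_pow_near (show (1:ℝ) ≤ 4 * l by linarith) (show (1:ℝ) < 2 by norm_num)
  rw [pow_succ] at hJ2
  have hJJ : J0 ≤ J := by
    have : (2:ℝ)^J0 < 2^J := by linarith
    exact ((pow_lt_pow_iff_right₀ (by norm_num)).mp this).le
  obtain ⟨q, hq, P, hPc, hP⟩ := hJ J hJJ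
  -- size of q
  have hbig : L ≤ (2:ℝ)^2^J := by
    have e1 : Real.log ((2:ℝ)^2^J) = 2^J * Real.log 2 := by rw [Real.log_pow]; push_cast; ring
    rw [← Real.log_le_log_iff hLpos (by positivity), e1]
    have := Real.log_two_gt_d9
    nlinarith
  have hqL : L ≤ q := hbig.trans (by exact_mod_cast hq)
  let D : ℝ := 8 * A * d^2 * l
  have hD : 0 < D := by positivity
  let r : ℕ := ⌊L / D⌋₊
  have hr1 : (r:ℝ) ≤ L / D := Nat.floor_le (by positivity)
  have hLD : 1 ≤ L / D := by
    rw [le_div_iff₀ hD]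
    have : l^2 / 2 ≤ L := by
      have h3 := Real.quadratic_le_exp_of_nonneg hlpos.le
      rw [hl, Real.exp_log hLpos, ← hl] at h3
      linarith
    have h4 : 16 * A * d^2 ≤ l := by linarith
    simp only [D]
    nlinarith
  have hr2 : L / (2 * D) ≤ r := by
    have h3 := Nat.lt_floor_add_one (L / D)
    have h4 : 1 ≤ r := Nat.le_floor (by simpa using hLD)
    have h5 : (1:ℝ) ≤ r := by exact_mod_cast h4
    have h6 : L / (2 * D) = (L / D) / 2 := by rw [mul_comm, div_mul_eq_div_div]
    rw [h6]
    have h7 : L / D < r + 1 := h3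
    linarith
  have hrl : (r:ℝ) * D ≤ L := by rwa [le_div_iff₀ hD] at hr1
  have h2r : r + r ≤ 2^2^J := by
    have h3 : (2:ℝ) ≤ D := by
      have : (1:ℝ) ≤ A * d^2 := by nlinarith
      simp only [D]; nlinarith
    have : ((r + r : ℕ) : ℝ) ≤ ((2^2^J : ℕ) : ℝ) := by
      push_cast
      have : (0:ℝ) ≤ r := Nat.cast_nonneg r
      nlinarith
    exact_mod_cast this
  obtain ⟨P', hP'P, hP'c⟩ := Finset.exists_subset_card_eq (hPc ▸ h2r)
  let e : Fin r ⊕ Fin r ≃ P' := Fintype.equivOfCardEq (by simp [hP'c])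
  have hprod : (∏ i, (e i : ℕ)) ≤ 2^(A * 2^J * (r + r)) := by
    calc (∏ i, (e i : ℕ)) ≤ ∏ i : Fin r ⊕ Fin r, 2^(A * 2^J) :=
          Finset.prod_le_prod' fun i _ => (hP _ (hP'P (e i).2)).2.1
      _ = _ := by simp [← pow_mul]
  have hm : (∏ i, (e i : ℕ))^(d*d) ≤ n := by
    refine (Nat.pow_le_pow_left hprod _).trans ?_
    rw [← pow_mul]
    have hnpos : (0:ℝ) < n := by exact_mod_cast hn1
    have : ((2 ^ (A * 2 ^ J * (r + r) * (d * d)) : ℕ) : ℝ) ≤ n := by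
      rw [← Real.log_le_log_iff (by positivity) hnpos]
      push_cast
      rw [Real.log_pow]
      push_cast
      have h3 : Real.log 2 ≤ 1 := by have := Real.log_two_lt_d9; linarith
      have h4 : (A:ℝ) * 2^J * (r + r) * (d*d) ≤ r * D := by
        have : (A:ℝ) * 2^J * (r + r) * (d*d) = (2 * A * r * d^2) * 2^J := by ring
        rw [this]
        have e2 : (r:ℝ) * D = (2 * A * r * d^2) * (4 * l) := by simp only [D]; ring
        rw [e2]
        gcongr
      have h5 : (0:ℝ) ≤ (A:ℝ) * 2^J * (r + r) * (d*d) := by positivity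
      calc _ ≤ (A:ℝ) * 2^J * (r + r) * (d*d) * 1 := mul_le_mul_of_nonneg_left h3 h5
        _ ≤ L := by rw [mul_one]; exact h4.trans hrl
    exact_mod_cast this
  have hmain := lower_count d n r q hd (fun i => (e i : ℕ))
    (fun i j h => e.injective (Subtype.ext h)) (fun i => (hP _ (hP'P (e i).2)).1)
    (fun i => (hP _ (hP'P (e i).2)).2.2) hm
  have hmain' : (q:ℝ)^(r*r) ≤ congCount d n := by exact_mod_cast hmain
  refine le_trans ?_ hmain'
  refine le_trans ?_ (pow_le_pow_left₀ hLpos.le hqL _)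
  have hnpos : (0:ℝ) < n := by exact_mod_cast hn1
  rw [← Real.log_le_log_iff (by positivity) (by positivity), Real.log_rpow hnpos, Real.log_pow, ← hL, ← hl]
  push_cast
  have h8 : (L / (2*D)) * (L / (2*D)) ≤ r * r := mul_self_le_mul_self (by positivity) hr2
  have h9 := mul_le_mul_of_nonneg_right h8 hlpos.le
  refine le_trans (le_of_eq ?_) h9
  simp only [D]
  field_simp
  ring

end CG

theorem congruence_growth_SLd_crude (d : ℕ) (hd : 2 ≤ d) :
    ∃ a b : ℝ, 0 < a ∧ 0 < b ∧ ∃ N : ℕ, ∀ n : ℕ, N ≤ n →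
      (n : ℝ) ^ (a * Real.log n / Real.log (Real.log n)) ≤ (congCount d n : ℝ) ∧
      (congCount d n : ℝ) ≤ (n : ℝ) ^ (b * Real.log n / Real.log (Real.log n)) := by
  obtain ⟨a, ha, N1, h1⟩ := CG.lower_main d hd
  obtain ⟨b, hb, N2, h2⟩ := CG.upper_main d hd
  exact ⟨a, b, ha, hb, max N1 N2, fun n hn =>
    ⟨h1 n ((le_max_left _ _).trans hn), h2 n ((le_max_right _ _).trans hn)⟩⟩
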